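/- arXiv:1906.00433 — 4 statements merged into one kernel-verified Lean document; each statement's English description precedes it below -/
import Mathlib

section
/- Let N ≥ 2 and α ≥ 0. Let (p_k) be a sequence of exponents with p_k > 1 and p_k → 1, and for each k let u_k be a nontrivial classical solution of the Hénon problem with exponent p_k. If sup_k ‖u_k‖_∞^{p_k−1} < ∞, then there exist a subsequence, a real number μ > 0, and a classical eigenfunction ω of the weighted eigenvalue problem with eigenvalue μ satisfying ‖ω‖_∞ = 1, such that along the subsequence ‖u_k‖_∞^{p_k−1} → μ and u_k/‖u_k‖_∞ → ω uniformly on the closed ball B̄ and, together with all derivatives up to order 2, uniformly on every compact subset of B. -/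
open Real MeasureTheory Metric Filter Topology

noncomputable section

/-- Euclidean space ℝ^N. -/
abbrev E (N : ℕ) := EuclideanSpace ℝ (Fin N)

/-- The Laplacian of `u : ℝ^N → ℝ`. -/
def lap {N : ℕ} (u : E N → ℝ) (x : E N) : ℝ :=
  ∑ i : Fin N, fderiv ℝ (fun y => fderiv ℝ u y (EuclideanSpace.single i 1)) x
    (EuclideanSpace.single i 1)

/-- The sup norm `‖u‖_∞` of `u` over the closed unit ball. -/
def supN {N : ℕ} (u : E N → ℝ) : ℝ := sSup ((fun x => |u x|) '' closedBall 0 1)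

/-- A classical solution of the Hénon problem with parameter `α` and exponent `p`:
`u ∈ C²(B) ∩ C(B̄)`, `−Δu = |x|^α |u|^{p−1} u` in `B`, `u = 0` on `∂B`. -/
def IsHenonSol (N : ℕ) (α p : ℝ) (u : E N → ℝ) : Prop :=
  ContDiffOn ℝ 2 u (ball 0 1) ∧ ContinuousOn u (closedBall 0 1) ∧
  (∀ x ∈ ball (0 : E N) 1, -lap u x = ‖x‖ ^ α * |u x| ^ (p - 1) * u x) ∧
  (∀ x : E N, ‖x‖ = 1 → u x = 0)

/-- A classical eigenfunction of the weighted eigenvalue problem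
`−Δω = μ |x|^α ω` in `B`, `ω = 0` on `∂B`, `ω` not identically zero. -/
def IsEigenfun (N : ℕ) (α μ : ℝ) (ω : E N → ℝ) : Prop :=
  ContDiffOn ℝ 2 ω (ball 0 1) ∧ ContinuousOn ω (closedBall 0 1) ∧
  (∃ x ∈ closedBall (0 : E N) 1, ω x ≠ 0) ∧
  (∀ x ∈ ball (0 : E N) 1, -lap ω x = μ * ‖x‖ ^ α * ω x) ∧
  (∀ x : E N, ‖x‖ = 1 → ω x = 0)

/-- The derivative of `f` in the direction `a`. -/
def dirDeriv {N : ℕ} (a : E N) (f : E N → ℝ) (x : E N) : ℝ := fderiv ℝ f x a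

section Kernels

variable {N : ℕ}

lemma contDiff_dirDeriv {n m : ℕ∞} {f : E N → ℝ} (hf : ContDiff ℝ m f) (h : n + 1 ≤ m)
    (a : E N) : ContDiff ℝ n (dirDeriv a f) :=
  (hf.fderiv_right (by exact_mod_cast h)).clm_apply contDiff_const

lemma hasCompactSupport_dirDeriv {f : E N → ℝ} (hf : HasCompactSupport f) (a : E N) :
    HasCompactSupport (dirDeriv a f) :=
  hf.fderiv_apply ℝ a

lemma dirDeriv_dirDeriv {f : E N → ℝ} {x : E N} (hf : ContDiffAt ℝ 2 f x) (a b : E N) :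
    dirDeriv a (dirDeriv b f) x = fderiv ℝ (fderiv ℝ f) x a b := by
  have h : DifferentiableAt ℝ (fderiv ℝ f) x :=
    (hf.fderiv_right (m := 1) (by norm_num)).differentiableAt (by norm_num)
  change fderiv ℝ (fun y => fderiv ℝ f y b) x a = _
  rw [fderiv_clm_apply h (differentiableAt_const b)]
  simp

lemma dirDeriv_comm {f : E N → ℝ} (hf : ContDiff ℝ 2 f) (a b : E N) :
    dirDeriv a (dirDeriv b f) = dirDeriv b (dirDeriv a f) := by
  ext x
  rw [dirDeriv_dirDeriv hf.contDiffAt, dirDeriv_dirDeriv hf.contDiffAt]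
  exact (hf.contDiffAt.isSymmSndFDerivAt (by simp)) a b

lemma dirDeriv_eq_sum (f : E N → ℝ) (x y : E N) :
    fderiv ℝ f x y = ∑ i, y i * dirDeriv (EuclideanSpace.single i 1) f x := by
  conv_lhs => rw [← (EuclideanSpace.basisFun (Fin N) ℝ).sum_repr y]
  simp [dirDeriv]

lemma integrable_kernel_mul {φ g : E N → ℝ} (hφ : Continuous φ) (hc : HasCompactSupport φ)
    (hg : Continuous g) : Integrable (fun y => φ y * g y) :=
  (hφ.mul hg).integrable_of_hasCompactSupport hc.mul_right

lemma fderiv_comp_dilation {g : E N → ℝ} (hg : ContDiff ℝ 1 g) (x : E N) (ε : ℝ) (y a : E N) :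
    fderiv ℝ (fun y => g (x + ε • y)) y a = ε * dirDeriv a g (x + ε • y) := by
  have h1 : HasFDerivAt (fun y : E N => x + ε • y) (ε • ContinuousLinearMap.id ℝ (E N)) y :=
    ((hasFDerivAt_id y).const_smul ε).const_add x
  have h2 := ((hg.differentiable (by norm_num)) (x + ε • y)).hasFDerivAt.comp y h1
  change fderiv ℝ (g ∘ fun y : E N => x + ε • y) y a = _
  rw [h2.fderiv]
  simp [dirDeriv]

/-- Integration by parts against a rescaled function. -/
lemma integral_dirDeriv_mul {φ g : E N → ℝ} (hφ : ContDiff ℝ 1 φ) (hc : HasCompactSupport φ)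
    (hg : ContDiff ℝ 1 g) (x a : E N) (ε : ℝ) :
    ∫ y, dirDeriv a φ y * g (x + ε • y) = -(ε * ∫ y, φ y * dirDeriv a g (x + ε • y)) := by
  have hg1 : ContDiff ℝ 1 (fun y : E N => g (x + ε • y)) :=
    hg.comp (contDiff_const.add (contDiff_id.const_smul ε))
  have hdg : Continuous (dirDeriv a g) :=
    (contDiff_dirDeriv (n := 0) (m := 1) hg (by simp) a).continuous
  have hdφ : Continuous (dirDeriv a φ) :=
    (contDiff_dirDeriv (n := 0) (m := 1) hφ (by simp) a).continuous
  have hlin : Continuous (fun y : E N => x + ε • y) := by fun_prop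
  have key := integral_mul_fderiv_eq_neg_fderiv_mul_of_integrable (μ := volume)
    (f := φ) (g := fun y => g (x + ε • y)) (v := a)
    (integrable_kernel_mul hdφ (hasCompactSupport_dirDeriv hc a) hg1.continuous)
    (by
      simp_rw [fderiv_comp_dilation hg]
      exact integrable_kernel_mul hφ.continuous hc (continuous_const.mul (hdg.comp hlin)))
    (integrable_kernel_mul hφ.continuous hc hg1.continuous)
    (fun y _ => hφ.differentiable (by norm_num) y) (fun y _ => hg1.differentiable (by norm_num) y)
  simp_rw [fderiv_comp_dilation hg, mul_left_comm _ ε] at key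
  rw [integral_const_mul] at key
  rw [key, neg_neg]
  rfl

/-- Directions may be exchanged between a kernel and the function it is integrated against. -/
lemma integral_dirDeriv_mul_dirDeriv_swap {φ g : E N → ℝ} (hφ : ContDiff ℝ 2 φ)
    (hc : HasCompactSupport φ) (hg : ContDiff ℝ 1 g) (x a b : E N) {ε : ℝ} (hε : ε ≠ 0) :
    ∫ y, dirDeriv a φ y * dirDeriv b g (x + ε • y) =
      ∫ y, dirDeriv b φ y * dirDeriv a g (x + ε • y) := by
  have h (c : E N) : ContDiff ℝ 1 (dirDeriv c φ) :=
    contDiff_dirDeriv (n := 1) (m := 2) hφ (by norm_num) c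
  have h1 := integral_dirDeriv_mul (h a) (hasCompactSupport_dirDeriv hc a) hg x b ε
  have h2 := integral_dirDeriv_mul (h b) (hasCompactSupport_dirDeriv hc b) hg x a ε
  rw [dirDeriv_comm hφ b a, h2] at h1
  exact (mul_left_cancel₀ hε (neg_injective h1)).symm

lemma hasDerivAt_integral_dilation {φ g : E N → ℝ} (hφ : Continuous φ)
    (hc : HasCompactSupport φ) (hg : ContDiff ℝ 1 g) (x : E N) (ε : ℝ) :
    HasDerivAt (fun ε : ℝ => ∫ y, φ y * g (x + ε • y))
      (∫ y, φ y * fderiv ℝ g (x + ε • y) y) ε := by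
  have hfg : Continuous (fderiv ℝ g) := hg.continuous_fderiv (by norm_num)
  have hcont : Continuous (fun q : ℝ × E N => φ q.2 * fderiv ℝ g (x + q.1 • q.2) q.2) := by
    refine (hφ.comp continuous_snd).mul ?_
    exact (hfg.comp (by fun_prop)).clm_apply continuous_snd
  obtain ⟨C, hC⟩ := ((isCompact_closedBall ε 1).prod hc.isCompact).exists_bound_of_continuousOn
    hcont.continuousOn
  refine (hasDerivAt_integral_of_dominated_loc_of_deriv_le (s := closedBall ε 1)
    (F' := fun ε y => φ y * fderiv ℝ g (x + ε • y) y)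
    (bound := (tsupport φ).indicator fun _ => C)
    (closedBall_mem_nhds ε one_pos) ?_ ?_ ?_ ?_ ?_ ?_).2
  · refine Eventually.of_forall fun t => ?_
    have : Continuous fun y => φ y * g (x + t • y) :=
      hφ.mul (hg.continuous.comp (by fun_prop))
    exact this.aestronglyMeasurable
  · exact integrable_kernel_mul hφ hc (hg.continuous.comp (by fun_prop))
  · have : Continuous fun y => φ y * fderiv ℝ g (x + ε • y) y :=
      hcont.comp (by fun_prop : Continuous fun y : E N => (ε, y))
    exact this.aestronglyMeasurable
  · refine Eventually.of_forall fun y t ht => ?_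
    by_cases hy : y ∈ tsupport φ
    · rw [Set.indicator_of_mem hy]
      exact hC (t, y) ⟨ht, hy⟩
    · simp [image_eq_zero_of_notMem_tsupport hy, hy]
  · rw [integrable_indicator_iff hc.isCompact.measurableSet]
    exact integrableOn_const hc.isCompact.measure_ne_top
  · refine Eventually.of_forall fun y t _ => ?_
    have h1 : HasDerivAt (fun t : ℝ => x + t • y) y t := by
      simpa using ((hasDerivAt_id t).smul_const y).const_add x
    have h2 := ((hg.differentiable (by norm_num)) (x + t • y)).hasFDerivAt.comp_hasDerivAt t h1
    exact h2.const_mul (φ y)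

lemma continuous_integral_dilation {φ g : E N → ℝ} (hφ : Continuous φ)
    (hc : HasCompactSupport φ) (hg : Continuous g) (x : E N) :
    Continuous (fun ε : ℝ => ∫ y, φ y * g (x + ε • y)) := by
  rw [← continuousOn_univ]
  refine continuousOn_integral_of_compact_support hc.isCompact ?_ ?_
  · have : Continuous (fun q : ℝ × E N => φ q.2 * g (x + q.1 • q.2)) :=
      (hφ.comp continuous_snd).mul (hg.comp (by fun_prop))
    exact this.continuousOn
  · intro t y _ hy
    simp [image_eq_zero_of_notMem_tsupport hy]

/-- A radial mollifier `η` with mass one, together with a potential `Ψ` of `y ↦ η y • y`. -/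
structure IsMollifierPair (Ψ η : E N → ℝ) : Prop where
  contDiff_potential : ContDiff ℝ 3 Ψ
  contDiff_mollifier : ContDiff ℝ 3 η
  potential_eq_zero : ∀ y, 1 ≤ ‖y‖ → Ψ y = 0
  mollifier_eq_zero : ∀ y, 1 ≤ ‖y‖ → η y = 0
  fderiv_potential : ∀ y a, fderiv ℝ Ψ y a = η y * inner ℝ y a
  integral_mollifier : ∫ y, η y = 1

lemma hasCompactSupport_of_eq_zero {φ : E N → ℝ} (h : ∀ y, 1 ≤ ‖y‖ → φ y = 0) :
    HasCompactSupport φ :=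
  HasCompactSupport.intro (isCompact_closedBall 0 1) fun y hy => h y (by
    simp only [mem_closedBall, dist_zero_right, not_le] at hy
    exact hy.le)

lemma exists_isMollifierPair (N : ℕ) : ∃ Ψ η : E N → ℝ, IsMollifierPair Ψ η := by
  set h : ℝ → ℝ := expNegInvGlue with hh
  have hs : ContDiff ℝ 4 h := expNegInvGlue.contDiff (n := 4)
  have hds : ContDiff ℝ 3 (deriv h) := hs.deriv' (n := 3)
  have hq : ContDiff ℝ 3 (fun y : E N => 1 - ‖y‖ ^ 2) :=
    contDiff_const.sub (contDiff_norm_sq ℝ)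
  have hd0 (t : ℝ) (ht : t ≤ 0) : deriv h t = 0 := by
    have hzero : ∀ s < 0, deriv h s = 0 := fun s hs' => by
      have : h =ᶠ[𝓝 s] fun _ => 0 := by
        filter_upwards [Iio_mem_nhds hs'] with z hz
        exact expNegInvGlue.zero_of_nonpos (le_of_lt hz)
      rw [this.deriv_eq]; simp
    have hcl : IsClosed {s | deriv h s = 0} := isClosed_eq hds.continuous continuous_const
    have : Set.Iic (0 : ℝ) ⊆ {s | deriv h s = 0} := by
      rw [← closure_Iio]
      exact hcl.closure_subset_iff.2 hzero
    exact this ht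
  have hnn (t : ℝ) : 0 ≤ deriv h t := expNegInvGlue.monotone.deriv_nonneg
  set η₀ : E N → ℝ := fun y => deriv h (1 - ‖y‖ ^ 2) with hη₀
  have hη₀s : ContDiff ℝ 3 η₀ := hds.comp hq
  have hη₀0 (y : E N) (hy : 1 ≤ ‖y‖) : η₀ y = 0 := hd0 _ (by nlinarith)
  have h1 : HasDerivAt h (Real.exp (-(1 : ℝ)⁻¹) * -(-(1 ^ 2 : ℝ)⁻¹)) 1 := by
    have h2 : HasDerivAt (fun t : ℝ => Real.exp (-t⁻¹))
        (Real.exp (-(1 : ℝ)⁻¹) * -(-(1 ^ 2 : ℝ)⁻¹)) 1 :=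
      ((hasDerivAt_inv one_ne_zero).neg).exp
    refine h2.congr_of_eventuallyEq ?_
    filter_upwards [Ioi_mem_nhds (zero_lt_one' ℝ)] with t ht
    simp [hh, expNegInvGlue, not_le.2 (Set.mem_Ioi.1 ht)]
  have hη₀c : HasCompactSupport η₀ := hasCompactSupport_of_eq_zero hη₀0
  have hpos : 0 < ∫ y, η₀ y := by
    refine hη₀s.continuous.integral_pos_of_hasCompactSupport_nonneg_nonzero hη₀c
      (fun y => hnn _) (x := 0) ?_
    simp only [hη₀, norm_zero, ne_eq, OfNat.ofNat_ne_zero, not_false_eq_true, zero_pow, sub_zero]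
    rw [h1.deriv]
    norm_num
  set c := ∫ y, η₀ y with hc
  refine ⟨fun y => c⁻¹ * (-(1 / 2) * h (1 - ‖y‖ ^ 2)), fun y => c⁻¹ * η₀ y, ?_, ?_, ?_, ?_, ?_, ?_⟩
  · exact contDiff_const.mul (contDiff_const.mul ((hs.of_le (by norm_num)).comp hq))
  · exact contDiff_const.mul hη₀s
  · intro y hy
    have : h (1 - ‖y‖ ^ 2) = 0 := expNegInvGlue.zero_of_nonpos (by nlinarith)
    simp [this]
  · intro y hy
    simp [hη₀0 y hy]
  · intro y a
    have e1 : HasFDerivAt (fun y : E N => 1 - ‖y‖ ^ 2) (-(2 • innerSL ℝ y)) y :=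
      (hasStrictFDerivAt_norm_sq y).hasFDerivAt.const_sub 1
    have e2 : HasDerivAt h (deriv h (1 - ‖y‖ ^ 2)) (1 - ‖y‖ ^ 2) :=
      (hs.differentiable (by norm_num) _).hasDerivAt
    have e3 := (((e2.comp_hasFDerivAt y e1).const_mul (-(1 / 2) : ℝ)).const_mul c⁻¹)
    have e4 : fderiv ℝ (fun y : E N => c⁻¹ * (-(1 / 2) * h (1 - ‖y‖ ^ 2))) y = _ := e3.fderiv
    rw [e4]
    simp [hη₀]
    ring
  · rw [integral_const_mul, ← hc, inv_mul_cancel₀ hpos.ne']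

end Kernels

section InteriorEstimates

variable {N : ℕ}

lemma abs_sub_le_of_abs_deriv_le_rpow {G G' : ℝ → ℝ} {r M β : ℝ} (hr : 0 < r) (hβ : 0 < β)
    (hc : ContinuousOn G (Set.Icc 0 r)) (hd : ∀ t ∈ Set.Ioo 0 r, HasDerivAt G (G' t) t)
    (hb : ∀ t ∈ Set.Ioo 0 r, |G' t| ≤ M * t ^ (β - 1)) :
    |G r - G 0| ≤ M * r ^ β / β := by
  have hP (t : ℝ) (ht : t ∈ Set.Ioo 0 r) :
      HasDerivAt (fun t : ℝ => M * t ^ β / β) (M * t ^ (β - 1)) t := by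
    exact (((Real.hasDerivAt_rpow_const (x := t) (p := β)
      (Or.inl ht.1.ne')).const_mul M).div_const β).congr_deriv (by field_simp)
  have hPc : ContinuousOn (fun t : ℝ => M * t ^ β / β) (Set.Icc 0 r) := by
    have : Continuous fun t : ℝ => t ^ β := Real.continuous_rpow_const hβ.le
    fun_prop
  have h0 : (0 : ℝ) ∈ Set.Icc 0 r := ⟨le_rfl, hr.le⟩
  have h1 : r ∈ Set.Icc 0 r := ⟨hr.le, le_rfl⟩
  have z : (0 : ℝ) ^ β = 0 := Real.zero_rpow hβ.ne'
  have hm : MonotoneOn (fun t => M * t ^ β / β + G t) (Set.Icc 0 r) := by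
    refine monotoneOn_of_deriv_nonneg (convex_Icc 0 r) (hPc.add hc) ?_ ?_ <;>
      rw [interior_Icc]
    · exact fun t ht => ((hP t ht).add (hd t ht)).differentiableAt.differentiableWithinAt
    · intro t ht
      refine le_of_le_of_eq ?_ ((hP t ht).add (hd t ht)).deriv.symm
      linarith [neg_le_of_abs_le (hb t ht)]
  have ha : MonotoneOn (fun t => M * t ^ β / β - G t) (Set.Icc 0 r) := by
    refine monotoneOn_of_deriv_nonneg (convex_Icc 0 r) (hPc.sub hc) ?_ ?_ <;>
      rw [interior_Icc]
    · exact fun t ht => ((hP t ht).sub (hd t ht)).differentiableAt.differentiableWithinAt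
    · intro t ht
      refine le_of_le_of_eq ?_ ((hP t ht).sub (hd t ht)).deriv.symm
      linarith [le_of_abs_le (hb t ht)]
  have i1 := hm h0 h1 hr.le
  have i2 := ha h0 h1 hr.le
  simp only [z] at i1 i2
  rw [abs_le]
  constructor <;> linarith [show M * 0 / β = 0 by simp]

lemma dirDeriv_eq_zero {φ : E N → ℝ} (h : ∀ y, 1 < ‖y‖ → φ y = 0) (a y : E N) (hy : 1 < ‖y‖) :
    dirDeriv a φ y = 0 := by
  have : φ =ᶠ[𝓝 y] fun _ => 0 := by
    filter_upwards [(isOpen_lt continuous_const continuous_norm).mem_nhds hy] with z hz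
    exact h z hz
  simp [dirDeriv, this.fderiv_eq]

lemma abs_integral_kernel_mul_le {φ κ g : E N → ℝ} {A m : ℝ} (hκ : Integrable κ)
    (hm : 0 ≤ m) (hκ0 : ∀ y, 0 ≤ κ y * A) (hφκ : ∀ y, |φ y| ≤ κ y * A)
    (hφ : ∀ y, 1 < ‖y‖ → φ y = 0) (hg : ∀ y, ‖y‖ ≤ 1 → |g y| ≤ m) :
    |∫ y, φ y * g y| ≤ (∫ y, κ y) * A * m := by
  rw [← integral_mul_const, ← integral_mul_const]
  refine norm_integral_le_of_norm_le (f := fun y => φ y * g y) ((hκ.mul_const A).mul_const m)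
    (Eventually.of_forall ?_)
  intro y
  rw [norm_mul, Real.norm_eq_abs, Real.norm_eq_abs]
  rcases le_or_gt ‖y‖ 1 with hy | hy
  · exact mul_le_mul (hφκ y) (hg y hy) (abs_nonneg _) (hκ0 y)
  · rw [hφ y hy, abs_zero, zero_mul]
    exact mul_nonneg (hκ0 y) hm

lemma abs_dirDeriv_le (f : E N → ℝ) (a y : E N) : |dirDeriv a f y| ≤ ‖fderiv ℝ f y‖ * ‖a‖ :=
  (fderiv ℝ f y).le_opNorm a

lemma abs_dirDeriv_dirDeriv_le {f : E N → ℝ} (hf : ContDiff ℝ 2 f) (a b y : E N) :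
    |dirDeriv a (dirDeriv b f) y| ≤ ‖fderiv ℝ (fderiv ℝ f) y‖ * (‖a‖ * ‖b‖) := by
  rw [dirDeriv_dirDeriv hf.contDiffAt, ← mul_assoc]
  exact (fderiv ℝ (fderiv ℝ f) y).le_opNorm₂ a b

lemma integrable_norm_fderiv {f : E N → ℝ} (hf : ContDiff ℝ 1 f) (hc : HasCompactSupport f) :
    Integrable fun y => ‖fderiv ℝ f y‖ :=
  ((hf.continuous_fderiv (by norm_num)).integrable_of_hasCompactSupport (hc.fderiv ℝ)).norm

lemma integrable_norm_fderiv_fderiv {f : E N → ℝ} (hf : ContDiff ℝ 2 f)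
    (hc : HasCompactSupport f) : Integrable fun y => ‖fderiv ℝ (fderiv ℝ f) y‖ :=
  (((hf.fderiv_right (m := 1) (by norm_num)).continuous_fderiv
    (by norm_num)).integrable_of_hasCompactSupport ((hc.fderiv ℝ).fderiv ℝ)).norm

lemma lap_eq_sum (f : E N → ℝ) (x : E N) :
    lap f x = ∑ i, dirDeriv (EuclideanSpace.single i 1)
      (dirDeriv (EuclideanSpace.single i 1) f) x := rfl

namespace IsMollifierPair

variable {Ψ η : E N → ℝ}

lemma dirDeriv_potential (h : IsMollifierPair Ψ η) (i : Fin N) :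
    dirDeriv (EuclideanSpace.single i 1) Ψ = fun y => η y * y i := by
  ext y
  rw [dirDeriv, h.fderiv_potential, EuclideanSpace.inner_single_right]
  simp

lemma hasCompactSupport_potential (h : IsMollifierPair Ψ η) : HasCompactSupport Ψ :=
  hasCompactSupport_of_eq_zero h.potential_eq_zero

lemma hasCompactSupport_mollifier (h : IsMollifierPair Ψ η) : HasCompactSupport η :=
  hasCompactSupport_of_eq_zero h.mollifier_eq_zero

/-- A divergence-type sum of integrals against a kernel collapses to the Laplacian. -/
lemma _root_.sum_integral_dirDeriv_mul_eq_lap {φ V : E N → ℝ} (hφ : ContDiff ℝ 2 φ)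
    (hc : HasCompactSupport φ) (hV : ContDiff ℝ 2 V) (x a : E N) {ε : ℝ} (hε : ε ≠ 0) :
    ∑ i, ∫ y, dirDeriv (EuclideanSpace.single i 1) φ y *
        dirDeriv (EuclideanSpace.single i 1) (dirDeriv a V) (x + ε • y) =
      ∫ y, dirDeriv a φ y * lap V (x + ε • y) := by
  have hd (c : E N) : ContDiff ℝ 1 (dirDeriv c V) :=
    contDiff_dirDeriv (n := 1) (m := 2) hV (by norm_num) c
  have hdd (c d : E N) : Continuous (dirDeriv d (dirDeriv c V)) :=
    (contDiff_dirDeriv (n := 0) (m := 1) (hd c) (by simp) d).continuous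
  simp_rw [dirDeriv_comm hV _ a, integral_dirDeriv_mul_dirDeriv_swap hφ hc (hd _) x _ a hε,
    lap_eq_sum, Finset.mul_sum]
  rw [integral_finsetSum]
  intro i _
  exact integrable_kernel_mul (contDiff_dirDeriv (n := 1) (m := 2) hφ (by norm_num) a).continuous
    (hasCompactSupport_dirDeriv hc a) ((hdd _ _).comp (by fun_prop))

lemma hasDerivAt_average_dirDeriv (h : IsMollifierPair Ψ η) {V : E N → ℝ} (hV : ContDiff ℝ 2 V)
    (x a : E N) {ε : ℝ} (hε : ε ≠ 0) :
    HasDerivAt (fun ε : ℝ => ∫ y, η y * dirDeriv a V (x + ε • y))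
      (∫ y, dirDeriv a Ψ y * lap V (x + ε • y)) ε := by
  have hd (c : E N) : ContDiff ℝ 1 (dirDeriv c V) :=
    contDiff_dirDeriv (n := 1) (m := 2) hV (by norm_num) c
  have hdd (c d : E N) : Continuous (dirDeriv d (dirDeriv c V)) :=
    (contDiff_dirDeriv (n := 0) (m := 1) (hd c) (by simp) d).continuous
  have hΨ : ContDiff ℝ 2 Ψ := h.contDiff_potential.of_le (by norm_num)
  convert hasDerivAt_integral_dilation h.contDiff_mollifier.continuous
    h.hasCompactSupport_mollifier (hd a) x ε using 1
  rw [← sum_integral_dirDeriv_mul_eq_lap hΨ h.hasCompactSupport_potential hV x a hε,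
    ← integral_finsetSum]
  · refine integral_congr_ae (Eventually.of_forall fun y => ?_)
    simp only [h.dirDeriv_potential]
    rw [dirDeriv_eq_sum, Finset.mul_sum]
    simp_rw [mul_assoc]
  · intro i _
    exact integrable_kernel_mul
      (contDiff_dirDeriv (n := 1) (m := 2) hΨ (by norm_num) _).continuous
      (hasCompactSupport_dirDeriv h.hasCompactSupport_potential _) ((hdd _ _).comp (by fun_prop))

lemma dirDeriv_mollifier_mul (h : IsMollifierPair Ψ η) (b y : E N) (i : Fin N) :
    dirDeriv b η y * y i =
      dirDeriv (EuclideanSpace.single i 1) (dirDeriv b Ψ) y - η y * b i := by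
  rw [dirDeriv_comm (h.contDiff_potential.of_le (by norm_num)), h.dirDeriv_potential]
  have h1 : HasFDerivAt η (fderiv ℝ η y) y :=
    (h.contDiff_mollifier.differentiable (by norm_num) y).hasFDerivAt
  have h2 : HasFDerivAt (fun y : E N => y i) (EuclideanSpace.proj i : E N →L[ℝ] ℝ) y :=
    (EuclideanSpace.proj i : E N →L[ℝ] ℝ).hasFDerivAt
  have h3 := (h1.mul h2).fderiv
  have h4 : dirDeriv b (fun y => η y * y i) y = _ := congrArg (fun L => L b) h3
  rw [h4]
  simp [dirDeriv]
  ring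

lemma hasDerivAt_average_dirDeriv_dirDeriv (h : IsMollifierPair Ψ η) {V : E N → ℝ}
    (hV : ContDiff ℝ 2 V) (x a b : E N) {ε : ℝ} (hε : ε ≠ 0) :
    HasDerivAt (fun ε : ℝ => ∫ y, η y * dirDeriv b (dirDeriv a V) (x + ε • y))
      (-(ε⁻¹ * ∫ y, dirDeriv a (dirDeriv b Ψ) y * lap V (x + ε • y))) ε := by
  have hd (c : E N) : ContDiff ℝ 1 (dirDeriv c V) :=
    contDiff_dirDeriv (n := 1) (m := 2) hV (by norm_num) c
  have hdd (c d : E N) : Continuous (dirDeriv d (dirDeriv c V)) :=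
    (contDiff_dirDeriv (n := 0) (m := 1) (hd c) (by simp) d).continuous
  have hη : ContDiff ℝ 1 η := h.contDiff_mollifier.of_le (by norm_num)
  have hηc := h.hasCompactSupport_mollifier
  have hdΨ : ContDiff ℝ 2 (dirDeriv b Ψ) :=
    contDiff_dirDeriv (n := 2) (m := 3) h.contDiff_potential (by norm_num) b
  have hdΨc := hasCompactSupport_dirDeriv h.hasCompactSupport_potential b
  have hB := hasDerivAt_integral_dilation (φ := dirDeriv b η)
    (contDiff_dirDeriv (n := 0) (m := 1) hη (by simp) b).continuous
    (hasCompactSupport_dirDeriv hηc b) (hd a) x ε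
  have hB' : ∫ y, dirDeriv b η y * fderiv ℝ (dirDeriv a V) (x + ε • y) y =
      (∫ y, dirDeriv a (dirDeriv b Ψ) y * lap V (x + ε • y)) -
        ∫ y, η y * dirDeriv b (dirDeriv a V) (x + ε • y) := by
    have hi (i : Fin N) : Integrable fun y =>
        dirDeriv (EuclideanSpace.single i 1) (dirDeriv b Ψ) y *
          dirDeriv (EuclideanSpace.single i 1) (dirDeriv a V) (x + ε • y) :=
      integrable_kernel_mul (contDiff_dirDeriv (n := 1) (m := 2) hdΨ (by norm_num) _).continuous
        (hasCompactSupport_dirDeriv hdΨc _) ((hdd _ _).comp (by fun_prop))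
    rw [← sum_integral_dirDeriv_mul_eq_lap hdΨ hdΨc hV x a hε,
      ← integral_finsetSum _ fun i _ => hi i, ← integral_sub]
    · refine integral_congr_ae (Eventually.of_forall fun y => ?_)
      simp only []
      rw [dirDeriv_eq_sum, show dirDeriv b (dirDeriv a V) (x + ε • y) = _ from
        dirDeriv_eq_sum (dirDeriv a V) (x + ε • y) b, Finset.mul_sum, Finset.mul_sum,
        ← Finset.sum_sub_distrib]
      refine Finset.sum_congr rfl fun i _ => ?_
      rw [← mul_assoc, h.dirDeriv_mollifier_mul]
      ring
    · exact integrable_finsetSum _ fun i _ => hi i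
    · exact integrable_kernel_mul hη.continuous hηc ((hdd _ _).comp (by fun_prop))
  have hG (t : ℝ) (ht : t ≠ 0) : ∫ y, η y * dirDeriv b (dirDeriv a V) (x + t • y) =
      -(t⁻¹ * ∫ y, dirDeriv b η y * dirDeriv a V (x + t • y)) := by
    rw [integral_dirDeriv_mul hη hηc (hd a)]
    field_simp
  have hq := ((hasDerivAt_inv hε).mul hB).neg
  refine (hq.congr_of_eventuallyEq ?_).congr_deriv ?_
  · filter_upwards [isOpen_ne.mem_nhds hε] with t ht
    exact hG t ht
  · rw [hB', hG ε hε]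
    field_simp
    ring

end IsMollifierPair

/-- Interior gradient estimate for the Laplacian. -/
theorem exists_gradient_estimate (N : ℕ) : ∃ C : ℝ, 0 ≤ C ∧ ∀ (V : E N → ℝ), ContDiff ℝ 2 V →
    ∀ (x : E N) (r m s : ℝ), 0 < r → (∀ z ∈ closedBall x r, |V z| ≤ m) →
      (∀ z ∈ closedBall x r, |lap V z| ≤ s) →
      ∀ a, |dirDeriv a V x| ≤ C * (m / r + r * s) * ‖a‖ := by
  obtain ⟨Ψ, η, h⟩ := exists_isMollifierPair N
  have hΨ : ContDiff ℝ 1 Ψ := h.contDiff_potential.of_le (by norm_num)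
  have hη : ContDiff ℝ 1 η := h.contDiff_mollifier.of_le (by norm_num)
  have iΨ := integrable_norm_fderiv hΨ h.hasCompactSupport_potential
  have iη := integrable_norm_fderiv hη h.hasCompactSupport_mollifier
  set CΨ := ∫ y, ‖fderiv ℝ Ψ y‖
  set Cη := ∫ y, ‖fderiv ℝ η y‖
  have hCΨ : 0 ≤ CΨ := integral_nonneg fun y => norm_nonneg (fderiv ℝ Ψ y)
  have hCη : 0 ≤ Cη := integral_nonneg fun y => norm_nonneg (fderiv ℝ η y)
  refine ⟨CΨ + Cη, by positivity, fun V hV x r m s hr hm hs a => ?_⟩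
  have hm0 : 0 ≤ m := (abs_nonneg _).trans (hm x (mem_closedBall_self hr.le))
  have hs0 : 0 ≤ s := (abs_nonneg _).trans (hs x (mem_closedBall_self hr.le))
  have hball (t : ℝ) (ht : t ∈ Set.Icc 0 r) (y : E N) (hy : ‖y‖ ≤ 1) :
      x + t • y ∈ closedBall x r := by
    rw [mem_closedBall, dist_eq_norm, add_sub_cancel_left, norm_smul, Real.norm_of_nonneg ht.1]
    nlinarith [ht.1, ht.2, norm_nonneg y]
  have hdV : ContDiff ℝ 1 (dirDeriv a V) :=
    contDiff_dirDeriv (n := 1) (m := 2) hV (by norm_num) a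
  have hr1 : |∫ y, η y * dirDeriv a V (x + r • y)| ≤ r⁻¹ * (Cη * ‖a‖ * m) := by
    have e := integral_dirDeriv_mul hη h.hasCompactSupport_mollifier
      (hV.of_le (by norm_num : (1 : WithTop ℕ∞) ≤ 2)) x a r
    have : ∫ y, η y * dirDeriv a V (x + r • y) =
        -(r⁻¹ * ∫ y, dirDeriv a η y * V (x + r • y)) := by
      rw [e]; field_simp
    rw [this, abs_neg, abs_mul, abs_of_pos (inv_pos.2 hr)]
    refine mul_le_mul_of_nonneg_left ?_ (inv_pos.2 hr).le
    refine abs_integral_kernel_mul_le iη hm0 (fun y => by positivity) (abs_dirDeriv_le η a)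
      (dirDeriv_eq_zero (fun y hy => h.mollifier_eq_zero y hy.le) a) fun y hy => ?_
    exact hm _ (hball r ⟨hr.le, le_rfl⟩ y hy)
  have hdiff := abs_sub_le_of_abs_deriv_le_rpow (β := 1) (M := CΨ * ‖a‖ * s) hr one_pos
    (continuous_integral_dilation hη.continuous h.hasCompactSupport_mollifier
      hdV.continuous x).continuousOn
    (fun t ht => h.hasDerivAt_average_dirDeriv hV x a ht.1.ne') (fun t ht => by
      rw [sub_self, Real.rpow_zero, mul_one]
      refine abs_integral_kernel_mul_le iΨ hs0 (fun y => by positivity) (abs_dirDeriv_le Ψ a)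
        (dirDeriv_eq_zero (fun y hy => h.potential_eq_zero y hy.le) a) fun y hy => ?_
      exact hs _ (hball t ⟨ht.1.le, ht.2.le⟩ y hy))
  have h0 : ∫ y, η y * dirDeriv a V (x + (0 : ℝ) • y) = dirDeriv a V x := by
    simp [integral_mul_const, h.integral_mollifier]
  rw [h0, Real.rpow_one, div_one] at hdiff
  have htri : |dirDeriv a V x| ≤ r⁻¹ * (Cη * ‖a‖ * m) + CΨ * ‖a‖ * s * r := by
    have := abs_sub_abs_le_abs_sub (dirDeriv a V x) (∫ y, η y * dirDeriv a V (x + r • y))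
    rw [abs_sub_comm] at this
    linarith
  refine htri.trans (le_of_sub_nonneg ?_)
  have : (CΨ + Cη) * (m / r + r * s) * ‖a‖ - (r⁻¹ * (Cη * ‖a‖ * m) + CΨ * ‖a‖ * s * r) =
      CΨ * (m / r) * ‖a‖ + Cη * (r * s) * ‖a‖ := by
    field_simp; ring
  rw [this]
  positivity

/-- Interior estimate of the second derivatives in terms of the Hölder seminorm of the
Laplacian. -/
theorem exists_hessian_estimate (N : ℕ) {β : ℝ} (hβ : 0 < β) :
    ∃ C : ℝ, 0 ≤ C ∧ ∀ (V : E N → ℝ), ContDiff ℝ 2 V →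
    ∀ (x : E N) (r m H : ℝ), 0 < r → 0 ≤ H → (∀ z ∈ closedBall x r, |V z| ≤ m) →
      (∀ z ∈ closedBall x r, |lap V z - lap V x| ≤ H * ‖z - x‖ ^ β) →
      ∀ a b, |dirDeriv b (dirDeriv a V) x| ≤ C * (m / r ^ 2 + H * r ^ β) * (‖a‖ * ‖b‖) := by
  obtain ⟨Ψ, η, h⟩ := exists_isMollifierPair N
  have hΨ : ContDiff ℝ 2 Ψ := h.contDiff_potential.of_le (by norm_num)
  have hη : ContDiff ℝ 2 η := h.contDiff_mollifier.of_le (by norm_num)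
  have hη1 : ContDiff ℝ 1 η := h.contDiff_mollifier.of_le (by norm_num)
  have iΨ := integrable_norm_fderiv_fderiv hΨ h.hasCompactSupport_potential
  have iη := integrable_norm_fderiv_fderiv hη h.hasCompactSupport_mollifier
  set CΨ := ∫ y, ‖fderiv ℝ (fderiv ℝ Ψ) y‖
  set Cη := ∫ y, ‖fderiv ℝ (fderiv ℝ η) y‖
  have hCΨ : 0 ≤ CΨ := integral_nonneg fun y => norm_nonneg (fderiv ℝ (fderiv ℝ Ψ) y)
  have hCη : 0 ≤ Cη := integral_nonneg fun y => norm_nonneg (fderiv ℝ (fderiv ℝ η) y)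
  refine ⟨CΨ / β + Cη, by positivity, fun V hV x r m H hr hH hm hHl a b => ?_⟩
  have hm0 : 0 ≤ m := (abs_nonneg _).trans (hm x (mem_closedBall_self hr.le))
  have hball (t : ℝ) (ht : t ∈ Set.Icc 0 r) (y : E N) (hy : ‖y‖ ≤ 1) :
      x + t • y ∈ closedBall x r := by
    rw [mem_closedBall, dist_eq_norm, add_sub_cancel_left, norm_smul, Real.norm_of_nonneg ht.1]
    nlinarith [ht.1, ht.2, norm_nonneg y]
  have hV1 : ContDiff ℝ 1 V := hV.of_le (by norm_num)
  have hdV : ContDiff ℝ 1 (dirDeriv a V) :=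
    contDiff_dirDeriv (n := 1) (m := 2) hV (by norm_num) a
  have hddV (c d : E N) : Continuous (dirDeriv d (dirDeriv c V)) :=
    (contDiff_dirDeriv (n := 0) (m := 1)
      (contDiff_dirDeriv (n := 1) (m := 2) hV (by norm_num) c) (by simp) d).continuous
  have hlap : Continuous (lap V) := by
    simp_rw [funext (lap_eq_sum V)]
    exact continuous_finsetSum _ fun i _ => hddV _ _
  have hr1 : |∫ y, η y * dirDeriv b (dirDeriv a V) (x + r • y)| ≤
      (r ^ 2)⁻¹ * (Cη * (‖a‖ * ‖b‖) * m) := by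
    have e1 := integral_dirDeriv_mul hη1 h.hasCompactSupport_mollifier hdV x b r
    have e2 := integral_dirDeriv_mul (φ := dirDeriv b η)
      (contDiff_dirDeriv (n := 1) (m := 2) hη (by norm_num) b)
      (hasCompactSupport_dirDeriv h.hasCompactSupport_mollifier b) hV1 x a r
    have : ∫ y, η y * dirDeriv b (dirDeriv a V) (x + r • y) =
        (r ^ 2)⁻¹ * ∫ y, dirDeriv a (dirDeriv b η) y * V (x + r • y) := by
      rw [e2, e1]; field_simp
    rw [this, abs_mul, abs_of_pos (inv_pos.2 (pow_pos hr 2))]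
    refine mul_le_mul_of_nonneg_left ?_ (by positivity)
    refine abs_integral_kernel_mul_le iη hm0 (fun y => by positivity)
      (abs_dirDeriv_dirDeriv_le hη a b)
      (dirDeriv_eq_zero (dirDeriv_eq_zero (fun y hy => h.mollifier_eq_zero y hy.le) b) a)
      fun y hy => ?_
    exact hm _ (hball r ⟨hr.le, le_rfl⟩ y hy)
  have hdΨ : ContDiff ℝ 1 (dirDeriv b Ψ) :=
    contDiff_dirDeriv (n := 1) (m := 2) hΨ (by norm_num) b
  have hdΨc := hasCompactSupport_dirDeriv h.hasCompactSupport_potential b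
  have hddΨ : Continuous (dirDeriv a (dirDeriv b Ψ)) :=
    (contDiff_dirDeriv (n := 0) (m := 1) hdΨ (by simp) a).continuous
  have hddΨc := hasCompactSupport_dirDeriv hdΨc a
  have hzero (c : ℝ) : ∫ y, dirDeriv a (dirDeriv b Ψ) y * c = 0 := by
    have := integral_dirDeriv_mul hdΨ hdΨc (contDiff_const (c := c)) x a 0
    simpa using this
  have hdiff := abs_sub_le_of_abs_deriv_le_rpow (M := CΨ * (‖a‖ * ‖b‖) * H) hr hβ
    (continuous_integral_dilation hη.continuous h.hasCompactSupport_mollifier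
      (hddV a b) x).continuousOn
    (fun t ht => h.hasDerivAt_average_dirDeriv_dirDeriv hV x a b ht.1.ne') (fun t ht => by
      have e : ∫ y, dirDeriv a (dirDeriv b Ψ) y * lap V (x + t • y) =
          ∫ y, dirDeriv a (dirDeriv b Ψ) y * (lap V (x + t • y) - lap V x) := by
        simp_rw [mul_sub]
        rw [integral_sub, hzero, sub_zero]
        · exact integrable_kernel_mul hddΨ hddΨc (hlap.comp (by fun_prop))
        · exact integrable_kernel_mul hddΨ hddΨc continuous_const
      have hb : |∫ y, dirDeriv a (dirDeriv b Ψ) y * (lap V (x + t • y) - lap V x)| ≤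
          CΨ * (‖a‖ * ‖b‖) * (H * t ^ β) := by
        refine abs_integral_kernel_mul_le iΨ (mul_nonneg hH (Real.rpow_nonneg ht.1.le _))
          (fun y => by positivity) (abs_dirDeriv_dirDeriv_le hΨ a b)
          (dirDeriv_eq_zero (dirDeriv_eq_zero (fun y hy => h.potential_eq_zero y hy.le) b) a)
          fun y hy => ?_
        refine (hHl _ (hball t ⟨ht.1.le, ht.2.le⟩ y hy)).trans
          (mul_le_mul_of_nonneg_left ?_ hH)
        refine Real.rpow_le_rpow (norm_nonneg _) ?_ hβ.le
        rw [add_sub_cancel_left, norm_smul, Real.norm_of_nonneg ht.1.le]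
        nlinarith [ht.1, norm_nonneg y]
      rw [e, abs_neg, abs_mul, abs_of_pos (inv_pos.2 ht.1), Real.rpow_sub_one ht.1.ne']
      calc t⁻¹ * _ ≤ t⁻¹ * (CΨ * (‖a‖ * ‖b‖) * (H * t ^ β)) :=
            mul_le_mul_of_nonneg_left hb (inv_pos.2 ht.1).le
        _ = _ := by ring)
  have h0 : ∫ y, η y * dirDeriv b (dirDeriv a V) (x + (0 : ℝ) • y) =
      dirDeriv b (dirDeriv a V) x := by
    simp [integral_mul_const, h.integral_mollifier]
  rw [h0] at hdiff
  have htri : |dirDeriv b (dirDeriv a V) x| ≤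
      (r ^ 2)⁻¹ * (Cη * (‖a‖ * ‖b‖) * m) + CΨ * (‖a‖ * ‖b‖) * H * r ^ β / β := by
    have := abs_sub_abs_le_abs_sub (dirDeriv b (dirDeriv a V) x)
      (∫ y, η y * dirDeriv b (dirDeriv a V) (x + r • y))
    rw [abs_sub_comm] at this
    linarith
  refine htri.trans (le_of_sub_nonneg ?_)
  have hrβ : 0 ≤ r ^ β := Real.rpow_nonneg hr.le _
  have : (CΨ / β + Cη) * (m / r ^ 2 + H * r ^ β) * (‖a‖ * ‖b‖) -
      ((r ^ 2)⁻¹ * (Cη * (‖a‖ * ‖b‖) * m) + CΨ * (‖a‖ * ‖b‖) * H * r ^ β / β) =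
      CΨ / β * (m / r ^ 2) * (‖a‖ * ‖b‖) + Cη * (H * r ^ β) * (‖a‖ * ‖b‖) := by
    field_simp; ring
  rw [this]
  positivity

end InteriorEstimates

section LocalEstimates

variable {N : ℕ}

lemma lap_congr {f g : E N → ℝ} {x : E N} (h : f =ᶠ[𝓝 x] g) : lap f x = lap g x := by
  refine Finset.sum_congr rfl fun i _ => ?_
  have : (fun y => fderiv ℝ f y (EuclideanSpace.single i 1)) =ᶠ[𝓝 x]
      fun y => fderiv ℝ g y (EuclideanSpace.single i 1) := by
    filter_upwards [h.fderiv (𝕜 := ℝ)] with y hy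
    rw [hy]
  rw [this.fderiv_eq]

lemma lap_eq_sum_fderiv {f : E N → ℝ} {x : E N} (hf : ContDiffAt ℝ 2 f x) :
    lap f x = ∑ i, fderiv ℝ (fderiv ℝ f) x (EuclideanSpace.single i 1)
      (EuclideanSpace.single i 1) :=
  Finset.sum_congr rfl fun _ _ => dirDeriv_dirDeriv hf _ _

lemma differentiableAt_fderiv_of_contDiffAt {f : E N → ℝ} {x : E N} (hf : ContDiffAt ℝ 2 f x) :
    DifferentiableAt ℝ (fderiv ℝ f) x :=
  (hf.fderiv_right (m := 1) (by norm_num)).differentiableAt (by norm_num)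

lemma fderiv_fderiv_sub {f g : E N → ℝ} {x : E N} (hf : ContDiffAt ℝ 2 f x)
    (hg : ContDiffAt ℝ 2 g x) :
    fderiv ℝ (fderiv ℝ (fun y => f y - g y)) x =
      fderiv ℝ (fderiv ℝ f) x - fderiv ℝ (fderiv ℝ g) x := by
  have : fderiv ℝ (fun y => f y - g y) =ᶠ[𝓝 x] fun y => fderiv ℝ f y - fderiv ℝ g y := by
    filter_upwards [hf.eventually (by simp), hg.eventually (by simp)] with y h1 h2
    exact fderiv_fun_sub (h1.differentiableAt (by norm_num)) (h2.differentiableAt (by norm_num))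
  rw [this.fderiv_eq]
  exact fderiv_fun_sub (differentiableAt_fderiv_of_contDiffAt hf)
    (differentiableAt_fderiv_of_contDiffAt hg)

lemma lap_sub {f g : E N → ℝ} {x : E N} (hf : ContDiffAt ℝ 2 f x) (hg : ContDiffAt ℝ 2 g x) :
    lap (fun y => f y - g y) x = lap f x - lap g x := by
  rw [lap_eq_sum_fderiv hf, lap_eq_sum_fderiv hg, lap_eq_sum_fderiv (hf.sub hg),
    ← Finset.sum_sub_distrib]
  refine Finset.sum_congr rfl fun i _ => ?_
  rw [fderiv_fderiv_sub hf hg]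
  simp

/-- A `C²` function on the unit ball agrees with a globally `C²` function on smaller balls. -/
lemma exists_contDiff_eqOn_ball {v : E N → ℝ} (hv : ContDiffOn ℝ 2 v (ball 0 1)) {ρ : ℝ}
    (h0 : 0 < ρ) (hρ : ρ < 1) :
    ∃ V : E N → ℝ, ContDiff ℝ 2 V ∧ Set.EqOn V v (ball 0 ρ) := by
  let χ : ContDiffBump (0 : E N) := ⟨ρ, (ρ + 1) / 2, h0, by linarith⟩
  refine ⟨fun x => χ x * v x, contDiff_iff_contDiffAt.2 fun x => ?_, fun x hx => ?_⟩
  · by_cases hx : x ∈ ball (0 : E N) 1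
    · exact χ.contDiff.contDiffAt.mul (hv.contDiffAt (isOpen_ball.mem_nhds hx))
    · have hxs : x ∉ tsupport χ := by
        rw [χ.tsupport_eq]
        simp only [mem_closedBall, mem_ball, dist_zero_right, not_le, not_lt] at hx ⊢
        change (ρ + 1) / 2 < ‖x‖
        linarith
      have : (fun x => χ x * v x) =ᶠ[𝓝 x] fun _ => 0 := by
        filter_upwards [(isClosed_tsupport χ).isOpen_compl.mem_nhds hxs] with z hz
        rw [image_eq_zero_of_notMem_tsupport hz, zero_mul]
      exact contDiffAt_const.congr_of_eventuallyEq this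
  · have : χ x = 1 := χ.one_of_mem_closedBall (ball_subset_closedBall hx)
    simp [this]

lemma norm_lt_of_mem_closedBall {x z : E N} {r : ℝ} (hz : z ∈ closedBall x r) :
    ‖z‖ ≤ ‖x‖ + r := by
  have := norm_le_norm_add_norm_sub' z x
  rw [mem_closedBall, dist_eq_norm] at hz
  linarith

lemma exists_contDiff_eventuallyEq {v : E N → ℝ} (hv : ContDiffOn ℝ 2 v (ball 0 1)) {x : E N}
    {r : ℝ} (hr : 0 < r) (hxr : ‖x‖ + r < 1) :
    ∃ V : E N → ℝ, ContDiff ℝ 2 V ∧ ∀ z ∈ closedBall x r, V =ᶠ[𝓝 z] v := by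
  obtain ⟨ρ, h1, h2⟩ := exists_between hxr
  obtain ⟨V, hV, hVv⟩ := exists_contDiff_eqOn_ball hv
    ((add_pos_of_nonneg_of_pos (norm_nonneg x) hr).trans h1) h2
  refine ⟨V, hV, fun z hz => hVv.eventuallyEq_of_mem (isOpen_ball.mem_nhds ?_)⟩
  rw [mem_ball_zero_iff]
  exact (norm_lt_of_mem_closedBall hz).trans_lt h1

theorem exists_local_gradient_estimate (N : ℕ) : ∃ C : ℝ, 0 ≤ C ∧ ∀ v : E N → ℝ,
    ContDiffOn ℝ 2 v (ball 0 1) → ∀ (x : E N) (r m s : ℝ), 0 < r → ‖x‖ + r < 1 →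
      (∀ z ∈ closedBall x r, |v z| ≤ m) → (∀ z ∈ closedBall x r, |lap v z| ≤ s) →
      ‖fderiv ℝ v x‖ ≤ C * (m / r + r * s) := by
  obtain ⟨C, hC, h⟩ := exists_gradient_estimate N
  refine ⟨C, hC, fun v hv x r m s hr hxr hm hs => ?_⟩
  obtain ⟨V, hV, hVv⟩ := exists_contDiff_eventuallyEq hv hr hxr
  have hx := mem_closedBall_self (x := x) hr.le
  have hm0 : 0 ≤ m := (abs_nonneg _).trans (hm x hx)
  have hs0 : 0 ≤ s := (abs_nonneg _).trans (hs x hx)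
  rw [← (hVv x hx).fderiv_eq]
  refine ContinuousLinearMap.opNorm_le_bound _ (by positivity) fun a => ?_
  exact h V hV x r m s hr (fun z hz => by rw [(hVv z hz).eq_of_nhds]; exact hm z hz)
    (fun z hz => by rw [lap_congr (hVv z hz)]; exact hs z hz) a

theorem exists_local_hessian_estimate (N : ℕ) {β : ℝ} (hβ : 0 < β) :
    ∃ C : ℝ, 0 ≤ C ∧ ∀ v : E N → ℝ, ContDiffOn ℝ 2 v (ball 0 1) →
      ∀ (x : E N) (r m H : ℝ), 0 < r → 0 ≤ H → ‖x‖ + r < 1 →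
      (∀ z ∈ closedBall x r, |v z| ≤ m) →
      (∀ z ∈ closedBall x r, |lap v z - lap v x| ≤ H * ‖z - x‖ ^ β) →
      ‖fderiv ℝ (fderiv ℝ v) x‖ ≤ C * (m / r ^ 2 + H * r ^ β) := by
  obtain ⟨C, hC, h⟩ := exists_hessian_estimate N hβ
  refine ⟨C, hC, fun v hv x r m H hr hH hxr hm hHl => ?_⟩
  obtain ⟨V, hV, hVv⟩ := exists_contDiff_eventuallyEq hv hr hxr
  have hx := mem_closedBall_self (x := x) hr.le
  have hm0 : 0 ≤ m := (abs_nonneg _).trans (hm x hx)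
  have hrβ : 0 ≤ r ^ β := Real.rpow_nonneg hr.le _
  rw [← ((hVv x hx).fderiv (𝕜 := ℝ)).fderiv_eq]
  refine ContinuousLinearMap.opNorm_le_bound₂ _ (by positivity) fun b a => ?_
  rw [← dirDeriv_dirDeriv hV.contDiffAt]
  refine (h V hV x r m H hr hH (fun z hz => by rw [(hVv z hz).eq_of_nhds]; exact hm z hz)
    (fun z hz => by rw [lap_congr (hVv z hz), lap_congr (hVv x hx)]; exact hHl z hz) a b).trans
    (le_of_eq ?_)
  ring

end LocalEstimates

section Limits

variable {N : ℕ}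

lemma exists_lt_one_subset_closedBall {K : Set (E N)} (hK : IsCompact K) (hKB : K ⊆ ball 0 1) :
    ∃ ρ, 0 < ρ ∧ ρ < 1 ∧ K ⊆ closedBall 0 ρ := by
  rcases K.eq_empty_or_nonempty with rfl | hne
  · exact ⟨1 / 2, by norm_num, by norm_num, Set.empty_subset _⟩
  · obtain ⟨x, hx, hmax⟩ := hK.exists_isMaxOn hne continuous_norm.continuousOn
    have hx1 : ‖x‖ < 1 := by simpa using hKB hx
    refine ⟨(‖x‖ + 1) / 2, by positivity, by linarith, fun y hy => ?_⟩
    have : ‖y‖ ≤ ‖x‖ := hmax hy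
    rw [mem_closedBall_zero_iff]
    linarith

/-- Passing to the limit in derivatives which are locally uniformly Cauchy. -/
lemma differentiableAt_and_tendstoUniformlyOn_fderiv {F : Type*} [NormedAddCommGroup F]
    [NormedSpace ℝ F] [CompleteSpace F] {w : ℕ → E N → F} {g : E N → F}
    (hw : ∀ n, ∀ x ∈ ball (0 : E N) 1, DifferentiableAt ℝ (w n) x)
    (hg : ∀ x ∈ ball (0 : E N) 1, Tendsto (fun n => w n x) atTop (𝓝 (g x)))
    (hc : ∀ ρ, 0 < ρ → ρ < 1 →
      UniformCauchySeqOn (fun n => fderiv ℝ (w n)) atTop (closedBall 0 ρ)) :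
    (∀ x ∈ ball (0 : E N) 1, DifferentiableAt ℝ g x) ∧
      ∀ K, IsCompact K → K ⊆ ball (0 : E N) 1 →
        TendstoUniformlyOn (fun n => fderiv ℝ (w n)) (fderiv ℝ g) atTop K := by
  have hlim (x : E N) : ∃ L, x ∈ ball (0 : E N) 1 →
      Tendsto (fun n => fderiv ℝ (w n) x) atTop (𝓝 L) := by
    by_cases hx : x ∈ ball (0 : E N) 1
    · obtain ⟨ρ, h0, h1, hρ⟩ := exists_lt_one_subset_closedBall isCompact_singleton
        (Set.singleton_subset_iff.2 hx)
      obtain ⟨L, hL⟩ := cauchySeq_tendsto_of_complete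
        ((hc ρ h0 h1).cauchySeq (hρ rfl))
      exact ⟨L, fun _ => hL⟩
    · exact ⟨0, fun h => absurd h hx⟩
  choose g' hg' using hlim
  have hu (ρ : ℝ) (h0 : 0 < ρ) (h1 : ρ < 1) :
      TendstoUniformlyOn (fun n => fderiv ℝ (w n)) g' atTop (closedBall 0 ρ) :=
    (hc ρ h0 h1).tendstoUniformlyOn_of_tendsto fun x hx =>
      hg' x (closedBall_subset_ball h1 hx)
  have hd (x : E N) (hx : x ∈ ball (0 : E N) 1) : HasFDerivAt g (g' x) x := by
    obtain ⟨ρ, h1, h2⟩ := exists_between (mem_ball_zero_iff.1 hx)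
    have hs : ball (0 : E N) ρ ⊆ ball 0 1 := ball_subset_ball h2.le
    exact hasFDerivAt_of_tendstoUniformlyOn isOpen_ball
      ((hu ρ ((norm_nonneg x).trans_lt h1) h2).mono ball_subset_closedBall)
      (fun n y hy => (hw n y (hs hy)).hasFDerivAt) (fun y hy => hg y (hs hy))
      (mem_ball_zero_iff.2 h1)
  refine ⟨fun x hx => (hd x hx).differentiableAt, fun K hK hKB => ?_⟩
  obtain ⟨ρ, h0, h1, hρ⟩ := exists_lt_one_subset_closedBall hK hKB
  exact ((hu ρ h0 h1).mono hρ).congr_right fun x hx => (hd x (hKB hx)).fderiv.symm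

lemma uniformCauchySeqOn_of_norm_sub_le {F : Type*} [NormedAddCommGroup F] {s : Set (E N)}
    {w : ℕ → E N → F} (h : ∀ ε > 0, ∃ n₀, ∀ m ≥ n₀, ∀ n ≥ n₀, ∀ x ∈ s, ‖w m x - w n x‖ < ε) :
    UniformCauchySeqOn w atTop s := by
  rw [Metric.uniformCauchySeqOn_iff]
  simpa [dist_eq_norm] using h

/-- A uniformly convergent sequence of `C²` functions whose Laplacians are bounded and locally
equi-Hölder converges in `C²` on compact sets. -/
theorem contDiffOn_and_tendstoUniformlyOn_fderiv {v : ℕ → E N → ℝ} {ω : E N → ℝ} {β s : ℝ}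
    (hβ : 0 < β) (hv : ∀ n, ContDiffOn ℝ 2 (v n) (ball 0 1))
    (hlim : TendstoUniformlyOn v ω atTop (ball 0 1))
    (hs : ∀ n, ∀ x ∈ ball (0 : E N) 1, |lap (v n) x| ≤ s)
    (hH : ∀ ρ, 0 < ρ → ρ < 1 → ∃ H, 0 ≤ H ∧ ∀ n, ∀ x ∈ closedBall (0 : E N) ρ,
      ∀ y ∈ closedBall (0 : E N) ρ, |lap (v n) x - lap (v n) y| ≤ H * ‖x - y‖ ^ β) :
    ContDiffOn ℝ 2 ω (ball 0 1) ∧ ∀ K, IsCompact K → K ⊆ ball (0 : E N) 1 →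
      TendstoUniformlyOn (fun n => fderiv ℝ (v n)) (fderiv ℝ ω) atTop K ∧
      TendstoUniformlyOn (fun n => fderiv ℝ (fderiv ℝ (v n))) (fderiv ℝ (fderiv ℝ ω)) atTop K := by
  have hvat (n : ℕ) (x : E N) (hx : x ∈ ball (0 : E N) 1) : ContDiffAt ℝ 2 (v n) x :=
    (hv n).contDiffAt (isOpen_ball.mem_nhds hx)
  have hs0 : 0 ≤ s := (abs_nonneg _).trans (hs 0 0 (mem_ball_self one_pos))
  have hcauchy := Metric.uniformCauchySeqOn_iff.1 hlim.uniformCauchySeqOn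
  have hlapsub (m n : ℕ) (x : E N) (hx : x ∈ ball (0 : E N) 1) :
      lap (fun y => v m y - v n y) x = lap (v m) x - lap (v n) x :=
    lap_sub (hvat m x hx) (hvat n x hx)
  have hin {ρ r : ℝ} (hr : ρ + r < 1) {x : E N} (hx : x ∈ closedBall (0 : E N) ρ) {z : E N}
      (hz : z ∈ closedBall x r) : z ∈ ball (0 : E N) 1 := by
    rw [mem_closedBall_zero_iff] at hx
    rw [mem_ball_zero_iff]
    linarith [norm_lt_of_mem_closedBall hz]
  have hgrad (ρ : ℝ) (h0 : 0 < ρ) (h1 : ρ < 1) :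
      UniformCauchySeqOn (fun n => fderiv ℝ (v n)) atTop (closedBall 0 ρ) := by
    refine uniformCauchySeqOn_of_norm_sub_le fun ε hε => ?_
    obtain ⟨C, hC, hest⟩ := exists_local_gradient_estimate N
    obtain ⟨r, hr0, hr1, hr2⟩ : ∃ r, 0 < r ∧ r < 1 - ρ ∧ C * (r * (s + s)) < ε / 2 := by
      have ht : Tendsto (fun r : ℝ => C * (r * (s + s))) (𝓝[>] 0) (𝓝 0) := by
        refine Tendsto.mono_left ?_ nhdsWithin_le_nhds
        exact Continuous.tendsto' (by fun_prop) _ _ (by simp)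
      obtain ⟨r, h1, h2, h3⟩ := ((eventually_mem_nhdsWithin (a := (0 : ℝ))).and
        ((eventually_nhdsWithin_of_eventually_nhds (eventually_lt_nhds (sub_pos.2 h1))).and
          (ht.eventually_lt_const (half_pos hε)))).exists
      exact ⟨r, h1, h2, h3⟩
    set δ := ε * r / (2 * (C + 1)) with hδ
    have hδ0 : 0 < δ := by positivity
    obtain ⟨n₀, hn₀⟩ := hcauchy δ hδ0
    refine ⟨n₀, fun m hm n hn x hx => ?_⟩
    have hx1 : x ∈ ball (0 : E N) 1 := closedBall_subset_ball h1 hx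
    have key := hest (fun y => v m y - v n y) ((hv m).sub (hv n)) x r δ (s + s) hr0
      (by rw [mem_closedBall_zero_iff] at hx; linarith)
      (fun z hz => (hn₀ m hm n hn z (hin (by linarith) hx hz)).le)
      (fun z hz => by
        have hz1 := hin (by linarith) hx hz
        rw [hlapsub m n z hz1]
        exact (abs_sub _ _).trans (add_le_add (hs m z hz1) (hs n z hz1)))
    rw [fderiv_fun_sub ((hvat m x hx1).differentiableAt (by norm_num))
      ((hvat n x hx1).differentiableAt (by norm_num))] at key
    have e : C * (δ / r) ≤ ε / 2 := by
      rw [hδ]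
      have : C * (ε * r / (2 * (C + 1)) / r) = ε / 2 * (C / (C + 1)) := by
        field_simp
      rw [this]
      exact mul_le_of_le_one_right (by positivity) ((div_le_one (by positivity)).2 (by linarith))
    rw [mul_add] at key
    linarith
  have hhess (ρ : ℝ) (h0 : 0 < ρ) (h1 : ρ < 1) :
      UniformCauchySeqOn (fun n => fderiv ℝ (fderiv ℝ (v n))) atTop (closedBall 0 ρ) := by
    refine uniformCauchySeqOn_of_norm_sub_le (w := fun n => fderiv ℝ (fderiv ℝ (v n)))
      fun ε hε => ?_
    obtain ⟨C, hC, hest⟩ := exists_local_hessian_estimate N hβ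
    obtain ⟨H, hH0, hH⟩ := hH ((ρ + 1) / 2) (by linarith) (by linarith)
    obtain ⟨r, hr0, hr1, hr2⟩ : ∃ r, 0 < r ∧ r < (1 - ρ) / 2 ∧ C * ((H + H) * r ^ β) < ε / 2 := by
      have ht : Tendsto (fun r : ℝ => C * ((H + H) * r ^ β)) (𝓝[>] 0) (𝓝 0) := by
        refine Tendsto.mono_left ?_ nhdsWithin_le_nhds
        have := Real.continuous_rpow_const hβ.le
        exact Continuous.tendsto' (by fun_prop) _ _ (by simp [Real.zero_rpow hβ.ne'])
      obtain ⟨r, h1, h2, h3⟩ := ((eventually_mem_nhdsWithin (a := (0 : ℝ))).and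
        ((eventually_nhdsWithin_of_eventually_nhds
          (eventually_lt_nhds (half_pos (sub_pos.2 h1)))).and
          (ht.eventually_lt_const (half_pos hε)))).exists
      exact ⟨r, h1, h2, h3⟩
    set δ := ε * r ^ 2 / (2 * (C + 1)) with hδ
    have hδ0 : 0 < δ := by positivity
    obtain ⟨n₀, hn₀⟩ := hcauchy δ hδ0
    refine ⟨n₀, fun m hm n hn x hx => ?_⟩
    have hx1 : x ∈ ball (0 : E N) 1 := closedBall_subset_ball h1 hx
    have hxρ : ‖x‖ ≤ ρ := mem_closedBall_zero_iff.1 hx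
    have hx2 : x ∈ closedBall (0 : E N) ((ρ + 1) / 2) := by
      rw [mem_closedBall_zero_iff]; linarith
    have key := hest (fun y => v m y - v n y) ((hv m).sub (hv n)) x r δ (H + H) hr0
      (by positivity) (by linarith)
      (fun z hz => (hn₀ m hm n hn z (hin (by linarith) hx hz)).le)
      (fun z hz => by
        have hz1 := hin (by linarith) hx hz
        have hz2 : z ∈ closedBall (0 : E N) ((ρ + 1) / 2) := by
          rw [mem_closedBall_zero_iff]
          linarith [norm_lt_of_mem_closedBall hz]
        rw [hlapsub m n z hz1, hlapsub m n x hx1, sub_sub_sub_comm, add_mul]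
        exact (abs_sub _ _).trans (add_le_add (hH m z hz2 x hx2) (hH n z hz2 x hx2)))
    rw [fderiv_fderiv_sub (hvat m x hx1) (hvat n x hx1)] at key
    have e : C * (δ / r ^ 2) ≤ ε / 2 := by
      rw [hδ]
      have : C * (ε * r ^ 2 / (2 * (C + 1)) / r ^ 2) = ε / 2 * (C / (C + 1)) := by
        field_simp
      rw [this]
      exact mul_le_of_le_one_right (by positivity) ((div_le_one (by positivity)).2 (by linarith))
    rw [mul_add] at key
    linarith
  obtain ⟨hd1, hu1⟩ := differentiableAt_and_tendstoUniformlyOn_fderiv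
    (fun n x hx => (hvat n x hx).differentiableAt (by norm_num))
    (fun x hx => hlim.tendsto_at hx) hgrad
  obtain ⟨hd2, hu2⟩ := differentiableAt_and_tendstoUniformlyOn_fderiv
    (fun n x hx => differentiableAt_fderiv_of_contDiffAt (hvat n x hx))
    (fun x hx => (hu1 {x} isCompact_singleton
      (Set.singleton_subset_iff.2 hx)).tendsto_at (Set.mem_singleton x)) hhess
  refine ⟨?_, fun K hK hKB => ⟨hu1 K hK hKB, hu2 K hK hKB⟩⟩
  have hcont : ContinuousOn (fderiv ℝ (fderiv ℝ ω)) (ball 0 1) := by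
    intro x hx
    obtain ⟨ρ, h1, h2⟩ := exists_between (mem_ball_zero_iff.1 hx)
    have hs' : closedBall (0 : E N) ρ ⊆ ball 0 1 := closedBall_subset_ball h2
    have hn : closedBall (0 : E N) ρ ∈ 𝓝 x :=
      mem_of_superset (isOpen_ball.mem_nhds (mem_ball_zero_iff.2 h1)) ball_subset_closedBall
    refine (ContinuousOn.continuousAt ?_ hn).continuousWithinAt
    refine (hu2 _ (isCompact_closedBall 0 ρ) hs').continuousOn (Frequently.of_forall fun n => ?_)
    intro y hy
    exact ((((hvat n y (hs' hy)).fderiv_right (m := 1) (by norm_num)).fderiv_right (m := 0)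
      (by norm_num)).continuousAt).continuousWithinAt
  have e2 : ContDiffOn ℝ 1 (fderiv ℝ ω) (ball 0 1) := by
    rw [show (1 : WithTop ℕ∞) = 0 + 1 by norm_num, contDiffOn_succ_iff_fderiv_of_isOpen isOpen_ball]
    exact ⟨fun x hx => (hd2 x hx).differentiableWithinAt, by simp, contDiffOn_zero.2 hcont⟩
  rw [show (2 : WithTop ℕ∞) = 1 + 1 by norm_num, contDiffOn_succ_iff_fderiv_of_isOpen isOpen_ball]
  exact ⟨fun x hx => (hd1 x hx).differentiableWithinAt, by simp, e2⟩

end Limits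

section MaximumPrinciple

variable {N : ℕ}

lemma dirDeriv_dirDeriv_nonpos_of_isLocalMax {z : E N → ℝ} {x : E N} (hz : ContDiffAt ℝ 2 z x)
    (hx : IsLocalMax z x) (a : E N) : dirDeriv a (dirDeriv a z) x ≤ 0 := by
  by_contra! hpos
  set g : ℝ → ℝ := fun t => z (x + t • a) with hg
  have hline (t : ℝ) : HasDerivAt (fun t : ℝ => x + t • a) a t := by
    simpa using ((hasDerivAt_id t).smul_const a).const_add x
  have hlim : Tendsto (fun t : ℝ => x + t • a) (𝓝 0) (𝓝 x) :=
    Continuous.tendsto' (by fun_prop) _ _ (by simp)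
  have hd : deriv g =ᶠ[𝓝 0] fun t => dirDeriv a z (x + t • a) := by
    filter_upwards [hlim.eventually (hz.eventually (by simp))] with t ht
    exact ((ht.differentiableAt (by norm_num)).hasFDerivAt.comp_hasDerivAt t (hline t)).deriv
  have hdz : DifferentiableAt ℝ (dirDeriv a z) x :=
    (differentiableAt_fderiv_of_contDiffAt hz).clm_apply (differentiableAt_const a)
  have hdd : deriv (deriv g) 0 = dirDeriv a (dirDeriv a z) x := by
    rw [hd.deriv_eq]
    have h0 : HasFDerivAt (dirDeriv a z) (fderiv ℝ (dirDeriv a z) x) (x + (0 : ℝ) • a) := by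
      simpa using hdz.hasFDerivAt
    exact (h0.comp_hasDerivAt 0 (hline 0)).deriv
  have hmax : IsLocalMax g 0 := by
    have : ∀ᶠ t in 𝓝 (0 : ℝ), z (x + t • a) ≤ z x := hlim.eventually hx
    simpa [IsLocalMax, IsMaxFilter, hg] using this
  have hcont : ContinuousAt g 0 := by
    have h0 : ContinuousAt z (x + (0 : ℝ) • a) := by simpa using hz.continuousAt
    exact ContinuousAt.comp (f := fun t : ℝ => x + t • a) h0 (hline 0).continuousAt
  have hmin := isLocalMin_of_deriv_deriv_pos (hdd ▸ hpos) hmax.deriv_eq_zero hcont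
  have hconst : g =ᶠ[𝓝 0] fun _ => g 0 := by
    filter_upwards [hmax, hmin] with t h1 h2
    exact le_antisymm h1 h2
  have : deriv g =ᶠ[𝓝 0] fun _ => 0 := by
    filter_upwards [hconst.eventuallyEq_nhds] with t ht
    rw [ht.deriv_eq, deriv_const]
  rw [← hdd, this.deriv_eq, deriv_const] at hpos
  exact lt_irrefl _ hpos

lemma nonpos_of_lap_pos {z : E N → ℝ} (hz : ContDiffOn ℝ 2 z (ball 0 1))
    (hc : ContinuousOn z (closedBall 0 1)) (hlap : ∀ x ∈ ball (0 : E N) 1, 0 < lap z x)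
    (hb : ∀ x, ‖x‖ = 1 → z x ≤ 0) {x : E N} (hx : x ∈ closedBall 0 1) : z x ≤ 0 := by
  obtain ⟨y, hy, hmax⟩ := (isCompact_closedBall (0 : E N) 1).exists_isMaxOn ⟨x, hx⟩ hc
  refine (hmax hx).trans ?_
  rcases (mem_closedBall_zero_iff.1 hy).lt_or_eq with h | h
  · have hyb : y ∈ ball (0 : E N) 1 := mem_ball_zero_iff.2 h
    have hn := isOpen_ball.mem_nhds hyb
    have hloc : IsLocalMax z y :=
      (hmax.isLocalMax (mem_of_superset hn ball_subset_closedBall))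
    refine absurd (hlap y hyb) (not_lt.2 (Finset.sum_nonpos fun i _ => ?_))
    exact dirDeriv_dirDeriv_nonpos_of_isLocalMax (hz.contDiffAt hn) hloc _
  · exact hb y h

lemma lap_const_mul_one_sub_norm_sq (c : ℝ) (x : E N) :
    lap (fun y : E N => c * (1 - ‖y‖ ^ 2)) x = -(2 * N * c) := by
  have h1 (i : Fin N) : dirDeriv (EuclideanSpace.single i 1) (fun y : E N => c * (1 - ‖y‖ ^ 2)) =
      fun y => (-(2 * c)) * y i := by
    ext y
    have e1 : HasFDerivAt (fun y : E N => 1 - ‖y‖ ^ 2) (-(2 • innerSL ℝ y)) y :=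
      (hasStrictFDerivAt_norm_sq y).hasFDerivAt.const_sub 1
    rw [dirDeriv, (e1.const_mul c).fderiv]
    simp [EuclideanSpace.inner_single_right]
    ring
  have h2 (i : Fin N) : dirDeriv (EuclideanSpace.single i 1)
      (fun y : E N => (-(2 * c)) * y i) x = -(2 * c) := by
    have h2 : HasFDerivAt (fun y : E N => y i) (EuclideanSpace.proj i : E N →L[ℝ] ℝ) x :=
      (EuclideanSpace.proj i : E N →L[ℝ] ℝ).hasFDerivAt
    rw [dirDeriv, (h2.const_mul _).fderiv]
    simp
  rw [lap_eq_sum]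
  simp_rw [h1, h2]
  simp
  ring

lemma le_mul_one_sub_norm_sq (hN : 1 ≤ N) {w : E N → ℝ} {c : ℝ} (hc0 : 0 < c)
    (hw : ContDiffOn ℝ 2 w (ball 0 1)) (hc : ContinuousOn w (closedBall 0 1))
    (hlap : ∀ x ∈ ball (0 : E N) 1, -c ≤ lap w x) (hb : ∀ x, ‖x‖ = 1 → w x = 0)
    {x : E N} (hx : x ∈ closedBall 0 1) : w x ≤ c * (1 - ‖x‖ ^ 2) := by
  have hq : ContDiff ℝ 2 (fun y : E N => c * (1 - ‖y‖ ^ 2)) :=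
    contDiff_const.mul (contDiff_const.sub (contDiff_norm_sq ℝ))
  have := nonpos_of_lap_pos (z := fun y => w y - c * (1 - ‖y‖ ^ 2)) (hw.sub hq.contDiffOn)
    (hc.sub hq.continuous.continuousOn) (fun y hy => ?_) (fun y hy => by simp [hb y hy, hy]) hx
  · linarith
  · rw [lap_sub (hw.contDiffAt (isOpen_ball.mem_nhds hy)) hq.contDiffAt,
      lap_const_mul_one_sub_norm_sq]
    have : (1 : ℝ) ≤ N := by exact_mod_cast hN
    nlinarith [hlap y hy]

end MaximumPrinciple

section PowerNonlinearity

lemma abs_rpow_sub_rpow_le_mul {q : ℝ} (hq : 1 ≤ q) {s t : ℝ} (hs : s ∈ Set.Icc (0 : ℝ) 1)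
    (ht : t ∈ Set.Icc (0 : ℝ) 1) : |s ^ q - t ^ q| ≤ q * |s - t| := by
  refine Convex.norm_image_sub_le_of_norm_hasDerivWithin_le (f := fun t : ℝ => t ^ q)
    (fun x _ => (Real.hasDerivAt_rpow_const (Or.inr hq)).hasDerivWithinAt) ?_
    (convex_Icc 0 1) ht hs
  intro x hx
  rw [Real.norm_of_nonneg (by have := Real.rpow_nonneg hx.1 (q - 1); positivity)]
  exact mul_le_of_le_one_right (by linarith) (Real.rpow_le_one hx.1 hx.2 (by linarith))

lemma abs_rpow_sub_rpow_le_rpow {q : ℝ} (hq0 : 0 ≤ q) (hq : q ≤ 1) {s t : ℝ} (hs : 0 ≤ s)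
    (ht : 0 ≤ t) : |s ^ q - t ^ q| ≤ |s - t| ^ q := by
  wlog h : t ≤ s generalizing s t
  · rw [abs_sub_comm, abs_sub_comm s]
    exact this ht hs (le_of_not_ge h)
  have h1 := Real.rpow_add_le_add_rpow ht (sub_nonneg.2 h) hq0 hq
  rw [add_sub_cancel] at h1
  rw [abs_of_nonneg (sub_nonneg.2 h), abs_of_nonneg (sub_nonneg.2 (Real.rpow_le_rpow ht h hq0))]
  linarith

lemma exists_holder_rpow {α : ℝ} (hα : 0 ≤ α) : ∃ A β : ℝ, 0 ≤ A ∧ 0 < β ∧ β ≤ 1 ∧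
    ∀ s ∈ Set.Icc (0 : ℝ) 1, ∀ t ∈ Set.Icc (0 : ℝ) 1, |s ^ α - t ^ α| ≤ A * |s - t| ^ β := by
  rcases hα.eq_or_lt with rfl | h0
  · exact ⟨0, 1, le_rfl, one_pos, le_rfl, by simp⟩
  rcases le_total α 1 with h1 | h1
  · refine ⟨1, α, zero_le_one, h0, h1, fun s hs t ht => ?_⟩
    rw [one_mul]
    exact abs_rpow_sub_rpow_le_rpow hα h1 hs.1 ht.1
  · refine ⟨α, 1, hα, one_pos, le_rfl, fun s hs t ht => ?_⟩
    rw [Real.rpow_one]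
    exact abs_rpow_sub_rpow_le_mul h1 hs ht

lemma abs_rpow_mul_self_of_nonneg {p t : ℝ} (hp : 1 < p) (ht : 0 ≤ t) :
    |t| ^ (p - 1) * t = t ^ p := by
  rw [abs_of_nonneg ht]
  rcases ht.eq_or_lt with rfl | h
  · rw [mul_zero, Real.zero_rpow (by linarith)]
  · rw [Real.rpow_sub_one h.ne', div_mul_cancel₀ _ h.ne']

lemma abs_rpow_mul_self_sub_le {p s t : ℝ} (hp : 1 < p) (hs : |s| ≤ 1) (ht : |t| ≤ 1) :
    |(|s| ^ (p - 1) * s - |t| ^ (p - 1) * t)| ≤ p * |s - t| := by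
  have hnn {s t : ℝ} (hs : |s| ≤ 1) (ht : |t| ≤ 1) (h0 : 0 ≤ s) (h1 : 0 ≤ t) :
      |(|s| ^ (p - 1) * s - |t| ^ (p - 1) * t)| ≤ p * |s - t| := by
    rw [abs_rpow_mul_self_of_nonneg hp h0, abs_rpow_mul_self_of_nonneg hp h1]
    exact abs_rpow_sub_rpow_le_mul hp.le ⟨h0, le_of_abs_le hs⟩ ⟨h1, le_of_abs_le ht⟩
  have hpn {s t : ℝ} (hs : |s| ≤ 1) (ht : |t| ≤ 1) (h0 : 0 ≤ s) (h1 : t ≤ 0) :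
      |(|s| ^ (p - 1) * s - |t| ^ (p - 1) * t)| ≤ p * |s - t| := by
    have a1 : |s| ^ (p - 1) ≤ 1 := Real.rpow_le_one (abs_nonneg _) hs (by linarith)
    have a2 : |t| ^ (p - 1) ≤ 1 := Real.rpow_le_one (abs_nonneg _) ht (by linarith)
    have b1 : 0 ≤ |s| ^ (p - 1) := Real.rpow_nonneg (abs_nonneg _) _
    have b2 : 0 ≤ |t| ^ (p - 1) := Real.rpow_nonneg (abs_nonneg _) _
    rw [abs_of_nonneg (show 0 ≤ s - t by linarith), abs_of_nonneg (by nlinarith)]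
    nlinarith
  rcases le_total 0 s with h0 | h0 <;> rcases le_total 0 t with h1 | h1
  · exact hnn hs ht h0 h1
  · exact hpn hs ht h0 h1
  · rw [abs_sub_comm, abs_sub_comm s]
    exact hpn ht hs h1 h0
  · have := hnn (s := -s) (t := -t) (by rwa [abs_neg]) (by rwa [abs_neg]) (by linarith)
      (by linarith)
    rw [abs_neg, abs_neg, mul_neg, mul_neg, neg_sub_neg, neg_sub_neg, abs_sub_comm,
      abs_sub_comm t] at this
    exact this

lemma le_two_mul_rpow {d β : ℝ} (h0 : 0 ≤ d) (h2 : d ≤ 2) (hβ0 : 0 < β) (hβ : β ≤ 1) :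
    d ≤ 2 * d ^ β := by
  rcases le_total d 1 with h | h
  · have := Real.rpow_le_rpow_of_exponent_ge_of_imp h0 h hβ (fun _ h' => absurd h' one_ne_zero)
    rw [Real.rpow_one] at this
    linarith [Real.rpow_nonneg h0 β]
  · linarith [Real.one_le_rpow h hβ0.le]

lemma tendsto_abs_rpow_mul_self {p t : ℕ → ℝ} {t₀ : ℝ} (hp : ∀ k, 1 < p k)
    (hp1 : Tendsto p atTop (𝓝 1)) (ht1 : ∀ k, |t k| ≤ 1) (ht : Tendsto t atTop (𝓝 t₀)) :
    Tendsto (fun k => |t k| ^ (p k - 1) * t k) atTop (𝓝 t₀) := by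
  have hq : Tendsto (fun k => p k - 1) atTop (𝓝 0) := by
    simpa using hp1.sub_const 1
  rcases eq_or_ne t₀ 0 with rfl | h0
  · refine squeeze_zero_norm (a := fun k => |t k|) (fun k => ?_) (by simpa using ht.abs)
    rw [Real.norm_eq_abs, abs_mul, abs_of_nonneg (Real.rpow_nonneg (abs_nonneg _) _)]
    exact mul_le_of_le_one_left (abs_nonneg _)
      (Real.rpow_le_one (abs_nonneg _) (ht1 k) (by linarith [hp k]))
  · have := (ht.abs.rpow hq (Or.inl (abs_ne_zero.2 h0))).mul ht
    simpa using this

end PowerNonlinearity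

section NormalizedSolutions

variable {N : ℕ}

/-! ### The sup norm -/

lemma exists_isMaxOn_abs {u : E N → ℝ} (hu : ContinuousOn u (closedBall 0 1)) :
    ∃ y ∈ closedBall (0 : E N) 1, IsMaxOn (fun x => |u x|) (closedBall 0 1) y :=
  (isCompact_closedBall (0 : E N) 1).exists_isMaxOn ⟨0, by simp⟩ hu.abs

lemma supN_eq_of_isMaxOn {u : E N → ℝ} {y : E N} (hy : y ∈ closedBall (0 : E N) 1)
    (hmax : IsMaxOn (fun x => |u x|) (closedBall 0 1) y) : supN u = |u y| := by
  refine IsGreatest.csSup_eq ⟨⟨y, hy, rfl⟩, ?_⟩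
  rintro _ ⟨x, hx, rfl⟩
  exact hmax hx

/-! ### Normalized solutions -/

/-- A solution of `−Δv = lam |x|^α |v|^{p−1} v` in the unit ball with zero boundary values and
sup norm one. -/
structure IsNormalizedSol (N : ℕ) (α p lam : ℝ) (v : E N → ℝ) : Prop where
  contDiffOn : ContDiffOn ℝ 2 v (ball 0 1)
  continuousOn : ContinuousOn v (closedBall 0 1)
  lap_eq : ∀ x ∈ ball (0 : E N) 1, -lap v x = lam * (‖x‖ ^ α * (|v x| ^ (p - 1) * v x))
  boundary : ∀ x : E N, ‖x‖ = 1 → v x = 0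
  abs_le_one : ∀ x ∈ closedBall (0 : E N) 1, |v x| ≤ 1
  exists_abs_eq_one : ∃ x ∈ closedBall (0 : E N) 1, |v x| = 1

lemma lap_div_const {u : E N → ℝ} {x : E N} (hu : ContDiffAt ℝ 2 u x) (M : ℝ) :
    lap (fun y => u y / M) x = lap u x / M := by
  have hev : ∀ᶠ y in 𝓝 x, ContDiffAt ℝ 2 u y := hu.eventually (by simp)
  have h1 : fderiv ℝ (fun y => u y / M) =ᶠ[𝓝 x] fun y => M⁻¹ • fderiv ℝ u y := by
    filter_upwards [hev] with y hy
    have hd : DifferentiableAt ℝ u y := hy.differentiableAt (by norm_num)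
    have : (fun y => u y / M) = fun y => M⁻¹ • u y := by
      ext y; simp [div_eq_inv_mul]
    rw [this, fderiv_fun_const_smul hd]
  have hc : ContDiffAt ℝ 2 (fun y => u y / M) x := hu.div_const M
  rw [lap_eq_sum_fderiv hc, lap_eq_sum_fderiv hu, h1.fderiv_eq,
    fderiv_fun_const_smul (differentiableAt_fderiv_of_contDiffAt hu), Finset.sum_div]
  refine Finset.sum_congr rfl fun i _ => ?_
  simp [div_eq_inv_mul]

lemma supN_pos {u : E N → ℝ} (hu : ContinuousOn u (closedBall 0 1))
    (hnt : ∃ x ∈ closedBall (0 : E N) 1, u x ≠ 0) : 0 < supN u := by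
  obtain ⟨y, hy, hmax⟩ := exists_isMaxOn_abs hu
  obtain ⟨x, hx, hx0⟩ := hnt
  rw [supN_eq_of_isMaxOn hy hmax]
  exact (abs_pos.2 hx0).trans_le (hmax hx)

lemma IsHenonSol.isNormalizedSol {α p : ℝ} {u : E N → ℝ} (hu : IsHenonSol N α p u)
    (hnt : ∃ x ∈ closedBall (0 : E N) 1, u x ≠ 0) :
    IsNormalizedSol N α p (supN u ^ (p - 1)) (fun x => u x / supN u) := by
  obtain ⟨h1, h2, h3, h4⟩ := hu
  have hM : 0 < supN u := supN_pos h2 hnt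
  obtain ⟨y, hy, hmax⟩ := exists_isMaxOn_abs h2
  have hMy := supN_eq_of_isMaxOn hy hmax
  refine ⟨h1.div_const _, h2.div_const _, fun x hx => ?_, fun x hx => by simp [h4 x hx],
    fun x hx => ?_, y, hy, ?_⟩
  · rw [lap_div_const (h1.contDiffAt (isOpen_ball.mem_nhds hx)), ← neg_div, h3 x hx, abs_div,
      abs_of_pos hM, Real.div_rpow (abs_nonneg _) hM.le]
    have := (Real.rpow_pos_of_pos hM (p - 1)).ne'
    field_simp
  · rw [abs_div, abs_of_pos hM, div_le_one hM, hMy]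
    exact hmax hx
  · rw [abs_div, abs_of_pos hM, div_eq_one_iff_eq hM.ne', hMy]

namespace IsNormalizedSol

variable {α p lam : ℝ} {v : E N → ℝ}

lemma abs_nonlinearity_le_one (h : IsNormalizedSol N α p lam v) (hp : 1 < p) {x : E N}
    (hx : x ∈ closedBall (0 : E N) 1) : |(|v x| ^ (p - 1) * v x)| ≤ 1 := by
  have := h.abs_le_one x hx
  rw [abs_mul, abs_of_nonneg (Real.rpow_nonneg (abs_nonneg _) _)]
  exact mul_le_one₀ (Real.rpow_le_one (abs_nonneg _) this (by linarith)) (abs_nonneg _) this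

lemma abs_lap_le (h : IsNormalizedSol N α p lam v) (hα : 0 ≤ α) (hp : 1 < p) (hlam : 0 ≤ lam)
    {x : E N} (hx : x ∈ ball (0 : E N) 1) : |lap v x| ≤ lam := by
  have hx' : ‖x‖ ≤ 1 := (mem_ball_zero_iff.1 hx).le
  rw [← abs_neg, h.lap_eq x hx, abs_mul, abs_of_nonneg hlam, abs_mul,
    abs_of_nonneg (Real.rpow_nonneg (norm_nonneg x) α)]
  refine mul_le_of_le_one_right hlam (mul_le_one₀ (Real.rpow_le_one (norm_nonneg _) hx' hα)
    (abs_nonneg _) (h.abs_nonlinearity_le_one hp (ball_subset_closedBall hx)))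

lemma abs_le_barrier (h : IsNormalizedSol N α p lam v) (hN : 1 ≤ N) (hα : 0 ≤ α) (hp : 1 < p)
    (hlam : 0 < lam) {x : E N} (hx : x ∈ closedBall (0 : E N) 1) :
    |v x| ≤ lam * (1 - ‖x‖ ^ 2) := by
  have hl := fun x hx => abs_le.1 (h.abs_lap_le hα hp hlam.le (x := x) hx)
  rw [abs_le']
  constructor
  · exact le_mul_one_sub_norm_sq hN hlam h.contDiffOn h.continuousOn (fun x hx => (hl x hx).1)
      h.boundary hx
  · have hneg : (fun x => v x / (-1)) = fun x => -v x :=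
      funext fun x => by rw [div_neg, div_one]
    refine le_mul_one_sub_norm_sq (w := fun x => -v x) hN hlam h.contDiffOn.neg
      h.continuousOn.neg (fun x hx => ?_) (fun x hx => by simp [h.boundary x hx]) hx
    rw [← hneg, lap_div_const (h.contDiffOn.contDiffAt (isOpen_ball.mem_nhds hx))]
    have := (hl x hx).2
    linarith [div_neg (lap v x) (b := 1), div_one (lap v x)]

lemma one_le (h : IsNormalizedSol N α p lam v) (hN : 1 ≤ N) (hα : 0 ≤ α) (hp : 1 < p)
    (hlam : 0 < lam) : 1 ≤ lam := by
  obtain ⟨x, hx, hx1⟩ := h.exists_abs_eq_one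
  have := h.abs_le_barrier hN hα hp hlam hx
  nlinarith [sq_nonneg ‖x‖]

lemma abs_le_two_mul_norm_sub (h : IsNormalizedSol N α p lam v) (hN : 1 ≤ N) (hα : 0 ≤ α)
    (hp : 1 < p) (hlam : 0 < lam) {x y : E N} (hx : ‖x‖ = 1)
    (hy : y ∈ closedBall (0 : E N) 1) : |v y| ≤ 2 * lam * ‖x - y‖ := by
  have hy1 : ‖y‖ ≤ 1 := mem_closedBall_zero_iff.1 hy
  have h1 := h.abs_le_barrier hN hα hp hlam hy
  have h2 := norm_sub_norm_le x y
  have h3 : 1 - ‖y‖ ^ 2 ≤ 2 * ‖x - y‖ := by nlinarith [norm_nonneg y]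
  nlinarith

end IsNormalizedSol

/-- Interior Lipschitz bounds for normalized solutions depend only on a bound for `lam`. -/
theorem exists_lipschitz_bound (N : ℕ) {α Λ ρ : ℝ} (hα : 0 ≤ α) (hΛ : 0 ≤ Λ) (hρ : ρ < 1) :
    ∃ L : ℝ, 0 ≤ L ∧ ∀ p lam v, 1 < p → 0 ≤ lam → lam ≤ Λ → IsNormalizedSol N α p lam v →
      ∀ x ∈ closedBall (0 : E N) ρ, ∀ y ∈ closedBall (0 : E N) ρ,
        |v x - v y| ≤ L * ‖x - y‖ := by
  obtain ⟨C, hC, hgrad⟩ := exists_local_gradient_estimate N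
  set r := (1 - ρ) / 2 with hr
  have hr0 : 0 < r := by rw [hr]; linarith
  refine ⟨C * (1 / r + r * Λ), by positivity, fun p lam v hp hlam0 hlam h x hx y hy => ?_⟩
  have hsub : closedBall (0 : E N) ρ ⊆ ball 0 1 := closedBall_subset_ball hρ
  have hxr : ∀ z ∈ closedBall (0 : E N) ρ, ‖z‖ + r < 1 := fun z hz => by
    have := mem_closedBall_zero_iff.1 hz
    rw [hr]; linarith
  have hin : ∀ z ∈ closedBall (0 : E N) ρ, ∀ w ∈ closedBall z r, w ∈ ball (0 : E N) 1 :=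
    fun z hz w hw => mem_ball_zero_iff.2 ((norm_lt_of_mem_closedBall hw).trans_lt (hxr z hz))
  have key := (convex_closedBall (0 : E N) ρ).norm_image_sub_le_of_norm_fderiv_le (𝕜 := ℝ)
    (f := v) (C := C * (1 / r + r * Λ))
    (fun z hz => (h.contDiffOn.contDiffAt (isOpen_ball.mem_nhds (hsub hz))).differentiableAt
      (by norm_num))
    (fun z hz => hgrad v h.contDiffOn z r 1 Λ hr0 (hxr z hz)
      (fun w hw => h.abs_le_one w (ball_subset_closedBall (hin z hz w hw)))
      (fun w hw => (h.abs_lap_le hα hp hlam0 (hin z hz w hw)).trans hlam)) hy hx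
  simpa [Real.norm_eq_abs] using key

/-- Interior Hölder bounds for the Laplacian of normalized solutions. -/
theorem exists_holder_lap_bound (N : ℕ) {α Λ P : ℝ} (hα : 0 ≤ α) (hΛ : 0 ≤ Λ) (hP : 0 ≤ P) :
    ∃ β : ℝ, 0 < β ∧ ∀ ρ, ρ < 1 → ∃ H : ℝ, 0 ≤ H ∧ ∀ p lam v, 1 < p → p ≤ P → 0 ≤ lam →
      lam ≤ Λ → IsNormalizedSol N α p lam v →
      ∀ x ∈ closedBall (0 : E N) ρ, ∀ y ∈ closedBall (0 : E N) ρ,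
        |lap v x - lap v y| ≤ H * ‖x - y‖ ^ β := by
  obtain ⟨A, β, hA, hβ0, hβ1, hhol⟩ := exists_holder_rpow hα
  refine ⟨β, hβ0, fun ρ hρ => ?_⟩
  obtain ⟨L, hL, hlip⟩ := exists_lipschitz_bound N hα hΛ hρ
  refine ⟨Λ * (A + P * (L * 2)), by positivity,
    fun p lam v hp hpP hlam0 hlam h x hx y hy => ?_⟩
  have hsub : closedBall (0 : E N) ρ ⊆ ball 0 1 := closedBall_subset_ball hρ
  have hx1 : ‖x‖ ≤ 1 := (mem_ball_zero_iff.1 (hsub hx)).le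
  have hy1 : ‖y‖ ≤ 1 := (mem_ball_zero_iff.1 (hsub hy)).le
  have hxv := h.abs_le_one x (ball_subset_closedBall (hsub hx))
  have hyv := h.abs_le_one y (ball_subset_closedBall (hsub hy))
  set f : E N → ℝ := fun z => |v z| ^ (p - 1) * v z with hf
  set D := ‖x - y‖ ^ β with hD
  have hD0 : 0 ≤ D := Real.rpow_nonneg (norm_nonneg _) _
  have hd : ‖x - y‖ ≤ 2 * D :=
    le_two_mul_rpow (norm_nonneg _) ((norm_sub_le x y).trans (by linarith)) hβ0 hβ1
  have hw : |‖x‖ ^ α - ‖y‖ ^ α| ≤ A * D :=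
    (hhol _ ⟨norm_nonneg x, hx1⟩ _ ⟨norm_nonneg y, hy1⟩).trans
      (mul_le_mul_of_nonneg_left
        (Real.rpow_le_rpow (abs_nonneg _) (abs_norm_sub_norm_le x y) hβ0.le) hA)
  have hfx : |f x| ≤ 1 := h.abs_nonlinearity_le_one hp (ball_subset_closedBall (hsub hx))
  have hfd : |f x - f y| ≤ P * (L * 2) * D := by
    calc |f x - f y| ≤ p * |v x - v y| := abs_rpow_mul_self_sub_le hp hxv hyv
      _ ≤ P * (L * (2 * D)) := by
        refine mul_le_mul hpP ?_ (abs_nonneg _) hP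
        exact (hlip p lam v hp hlam0 hlam h x hx y hy).trans (mul_le_mul_of_nonneg_left hd hL)
      _ = P * (L * 2) * D := by ring
  have hya : ‖y‖ ^ α ≤ 1 := Real.rpow_le_one (norm_nonneg _) hy1 hα
  have hya0 : 0 ≤ ‖y‖ ^ α := Real.rpow_nonneg (norm_nonneg _) _
  have e : lap v x - lap v y
      = -(lam * ((‖x‖ ^ α - ‖y‖ ^ α) * f x + ‖y‖ ^ α * (f x - f y))) := by
    have ex := h.lap_eq x (hsub hx)
    have ey := h.lap_eq y (hsub hy)
    simp only [hf]
    linear_combination ey - ex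
  rw [e, abs_neg, abs_mul, abs_of_nonneg hlam0]
  calc lam * |(‖x‖ ^ α - ‖y‖ ^ α) * f x + ‖y‖ ^ α * (f x - f y)|
      ≤ Λ * (A * D * 1 + 1 * (P * (L * 2) * D)) := by
        refine mul_le_mul hlam ((abs_add_le _ _).trans (add_le_add ?_ ?_)) (abs_nonneg _) hΛ
        · rw [abs_mul]
          exact mul_le_mul hw hfx (abs_nonneg _) (by positivity)
        · rw [abs_mul, abs_of_nonneg hya0]
          exact mul_le_mul hya hfd (abs_nonneg _) zero_le_one
    _ = Λ * (A + P * (L * 2)) * D := by ring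

/-! ### Compactness -/

/-- The restrictions of normalized solutions to the closed ball are equicontinuous. -/
theorem equicontinuous_of_isNormalizedSol {α Λ : ℝ} (hN : 1 ≤ N) (hα : 0 ≤ α) {p lam : ℕ → ℝ}
    {v : ℕ → E N → ℝ} (hp : ∀ k, 1 < p k) (hlam0 : ∀ k, 0 < lam k) (hlam : ∀ k, lam k ≤ Λ)
    (h : ∀ k, IsNormalizedSol N α (p k) (lam k) (v k)) :
    Equicontinuous (fun k (x : closedBall (0 : E N) 1) => v k x) := by
  have hΛ : 0 < Λ := (hlam0 0).trans_le (hlam 0)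
  rintro ⟨x, hx⟩
  obtain hx1 | hx1 := (mem_closedBall_zero_iff.1 hx).lt_or_eq
  · obtain ⟨L, hL, hlip⟩ := exists_lipschitz_bound N (ρ := (1 + ‖x‖) / 2) hα hΛ.le (by linarith)
    rw [Metric.equicontinuousAt_iff]
    intro ε hε
    refine ⟨min ((1 - ‖x‖) / 2) (ε / (L + 1)), lt_min (by linarith) (by positivity), ?_⟩
    rintro ⟨y, hy⟩ hyx k
    rw [Subtype.dist_eq, lt_min_iff, dist_eq_norm] at hyx
    have hyn : ‖y‖ ≤ ‖x‖ + ‖y - x‖ := by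
      simpa using norm_add_le x (y - x)
    have hle := hlip _ _ _ (hp k) (hlam0 k).le (hlam k) (h k) x
      (mem_closedBall_zero_iff.2 (by linarith)) y
      (mem_closedBall_zero_iff.2 (by linarith [hyx.1]))
    have h2 := (lt_div_iff₀ (by positivity)).1 hyx.2
    rw [Real.dist_eq]
    rw [norm_sub_rev] at hle
    nlinarith [norm_nonneg (y - x)]
  · rw [Metric.equicontinuousAt_iff]
    intro ε hε
    refine ⟨ε / (2 * Λ), by positivity, ?_⟩
    rintro ⟨y, hy⟩ hyx k
    rw [Subtype.dist_eq, dist_comm, dist_eq_norm, lt_div_iff₀ (by positivity)] at hyx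
    have hle := (h k).abs_le_two_mul_norm_sub hN hα (hp k) (hlam0 k) hx1 hy
    have hl := mul_le_mul_of_nonneg_right (hlam k) (norm_nonneg (x - y))
    rw [Real.dist_eq, (h k).boundary x hx1, zero_sub, abs_neg]
    simp only at hyx
    nlinarith

/-- Arzelà–Ascoli on a compact set, for functions on the ambient space. -/
theorem exists_subseq_tendstoUniformlyOn {X : Type*} [TopologicalSpace X] {s : Set X}
    (hs : IsCompact s) {v : ℕ → X → ℝ} {m : ℝ} (hc : ∀ k, ContinuousOn (v k) s)
    (hm : ∀ k, ∀ x ∈ s, |v k x| ≤ m) (heq : Equicontinuous (fun k (x : s) => v k x)) :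
    ∃ (φ : ℕ → ℕ) (ω : X → ℝ), StrictMono φ ∧
      TendstoUniformlyOn (fun k => v (φ k)) ω atTop s := by
  classical
  have : CompactSpace s := isCompact_iff_compactSpace.1 hs
  let F : ℕ → BoundedContinuousFunction s ℝ := fun k =>
    BoundedContinuousFunction.mkOfCompact ⟨fun x : s => v k x, (hc k).domRestrict⟩
  have hcomp := BoundedContinuousFunction.arzela_ascoli (Set.Icc (-m) m) isCompact_Icc
    (Set.range F)
    (by
      rintro _ x ⟨k, rfl⟩
      exact abs_le.1 (hm k x x.2))
    (by
      intro x U hU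
      filter_upwards [heq x U hU] with y hy
      rintro ⟨_, k, rfl⟩
      exact hy k)
  obtain ⟨G, -, φ, hφ, hG⟩ := hcomp.tendsto_subseq (fun k => subset_closure ⟨k, rfl⟩ :
    ∀ k, F k ∈ closure (Set.range F))
  refine ⟨φ, fun x => if hx : x ∈ s then G ⟨x, hx⟩ else 0, hφ, ?_⟩
  rw [tendstoUniformlyOn_iff_tendstoUniformly_comp_coe]
  convert BoundedContinuousFunction.tendsto_iff_tendstoUniformly.1 hG using 1
  · rfl
  · ext x
    simp

/-- A uniform limit of normalized solutions attains the sup norm one. -/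
lemma supN_eq_one_of_tendstoUniformlyOn {v : ℕ → E N → ℝ} {ω : E N → ℝ}
    (hω : ContinuousOn ω (closedBall 0 1))
    (hlim : TendstoUniformlyOn v ω atTop (closedBall 0 1))
    (h1 : ∀ k, ∀ x ∈ closedBall (0 : E N) 1, |v k x| ≤ 1)
    (h2 : ∀ k, ∃ x ∈ closedBall (0 : E N) 1, |v k x| = 1) : supN ω = 1 := by
  obtain ⟨y, hy, hmax⟩ := exists_isMaxOn_abs hω
  rw [supN_eq_of_isMaxOn hy hmax]
  refine le_antisymm ?_ (le_of_forall_pos_le_add fun ε hε => ?_)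
  · exact le_of_tendsto (hlim.tendsto_at hy).abs (Eventually.of_forall fun k => h1 k y hy)
  · obtain ⟨k, hk⟩ := (Metric.tendstoUniformlyOn_iff.1 hlim ε hε).exists
    obtain ⟨x, hx, hx1⟩ := h2 k
    have h3 := hk x hx
    have h4 : |ω x| ≤ |ω y| := hmax hx
    rw [Real.dist_eq, abs_sub_comm] at h3
    have := abs_sub_abs_le_abs_sub (v k x) (ω x)
    linarith

/-- Compactness of sequences of normalized solutions as the exponents tend to one. -/
theorem exists_subseq_tendsto_eigenfun (hN : 1 ≤ N) {α Λ : ℝ} (hα : 0 ≤ α) {p lam : ℕ → ℝ}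
    {v : ℕ → E N → ℝ} (hp : ∀ k, 1 < p k) (hp1 : Tendsto p atTop (𝓝 1))
    (hlam0 : ∀ k, 0 < lam k) (hlam : ∀ k, lam k ≤ Λ)
    (h : ∀ k, IsNormalizedSol N α (p k) (lam k) (v k)) :
    ∃ φ : ℕ → ℕ, StrictMono φ ∧ ∃ (μ : ℝ) (ω : E N → ℝ), 0 < μ ∧ IsEigenfun N α μ ω ∧
      supN ω = 1 ∧ Tendsto (fun k => lam (φ k)) atTop (𝓝 μ) ∧
      TendstoUniformlyOn (fun k => v (φ k)) ω atTop (closedBall 0 1) ∧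
      ∀ K : Set (E N), IsCompact K → K ⊆ ball 0 1 →
        TendstoUniformlyOn (fun k => fderiv ℝ (v (φ k))) (fderiv ℝ ω) atTop K ∧
        TendstoUniformlyOn (fun k => fderiv ℝ (fderiv ℝ (v (φ k)))) (fderiv ℝ (fderiv ℝ ω))
          atTop K := by
  have hΛ : 0 < Λ := (hlam0 0).trans_le (hlam 0)
  obtain ⟨P, hP⟩ := hp1.bddAbove_range
  replace hP : ∀ k, p k ≤ P := fun k => hP ⟨k, rfl⟩
  have hP0 : 0 ≤ P := by linarith [hp 0, hP 0]
  obtain ⟨ψ, ω, hψ, hψω⟩ := exists_subseq_tendstoUniformlyOn (isCompact_closedBall (0 : E N) 1)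
    (fun k => (h k).continuousOn) (fun k => (h k).abs_le_one)
    (equicontinuous_of_isNormalizedSol hN hα hp hlam0 hlam h)
  obtain ⟨μ, ⟨hμ1, -⟩, χ, hχ, hμ⟩ := (isCompact_Icc (a := (1 : ℝ)) (b := Λ)).tendsto_subseq
    (fun k => ⟨(h (ψ k)).one_le hN hα (hp _) (hlam0 _), hlam _⟩ : ∀ k, lam (ψ k) ∈ Set.Icc 1 Λ)
  set φ := ψ ∘ χ with hφdef
  have hφ : StrictMono φ := hψ.comp hχ
  have hμ' : Tendsto (fun k => lam (φ k)) atTop (𝓝 μ) := hμ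
  have hlim : TendstoUniformlyOn (fun k => v (φ k)) ω atTop (closedBall 0 1) :=
    fun U hU => hχ.tendsto_atTop.eventually (hψω U hU)
  have hωc : ContinuousOn ω (closedBall 0 1) :=
    hlim.continuousOn (Frequently.of_forall fun k => (h (φ k)).continuousOn)
  have hsup : supN ω = 1 := supN_eq_one_of_tendstoUniformlyOn hωc hlim
    (fun k => (h (φ k)).abs_le_one) (fun k => (h (φ k)).exists_abs_eq_one)
  obtain ⟨β, hβ, hhol⟩ := exists_holder_lap_bound N hα hΛ.le hP0
  obtain ⟨hωd, hder⟩ := contDiffOn_and_tendstoUniformlyOn_fderiv (v := fun k => v (φ k)) (s := Λ)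
    hβ (fun k => (h (φ k)).contDiffOn) (hlim.mono ball_subset_closedBall)
    (fun k x hx => ((h (φ k)).abs_lap_le hα (hp _) (hlam0 _).le hx).trans (hlam _))
    (fun ρ _ hρ => by
      obtain ⟨H, hH, hb⟩ := hhol ρ hρ
      exact ⟨H, hH, fun k => hb _ _ _ (hp _) (hP _) (hlam0 _).le (hlam _) (h (φ k))⟩)
  have hpt : ∀ x ∈ closedBall (0 : E N) 1, Tendsto (fun k => v (φ k) x) atTop (𝓝 (ω x)) :=
    fun x hx => hlim.tendsto_at hx
  refine ⟨φ, hφ, μ, ω, by linarith, ⟨hωd, hωc, ?_, fun x hx => ?_, fun x hx => ?_⟩, hsup, hμ',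
    hlim, hder⟩
  · obtain ⟨y, hy, hmax⟩ := exists_isMaxOn_abs hωc
    refine ⟨y, hy, fun h0 => ?_⟩
    rw [supN_eq_of_isMaxOn hy hmax, h0, abs_zero] at hsup
    exact zero_ne_one hsup
  · have hxn := isOpen_ball.mem_nhds hx
    have hxc := ball_subset_closedBall hx
    have hH := (hder {x} isCompact_singleton (by simpa using hx)).2.tendsto_at
      (Set.mem_singleton x)
    have h1 : Tendsto (fun k => -lap (v (φ k)) x) atTop (𝓝 (-lap ω x)) := by
      rw [lap_eq_sum_fderiv (hωd.contDiffAt hxn)]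
      simp_rw [fun k => lap_eq_sum_fderiv ((h (φ k)).contDiffOn.contDiffAt hxn)]
      refine (tendsto_finsetSum _ fun i _ => ?_).neg
      exact ((continuous_eval_const (EuclideanSpace.single i (1 : ℝ))).tendsto _).comp
        (((continuous_eval_const (EuclideanSpace.single i (1 : ℝ))).tendsto _).comp hH)
    have h2 := hμ'.mul ((tendsto_const_nhds (x := ‖x‖ ^ α)).mul
      (tendsto_abs_rpow_mul_self (fun k => hp (φ k)) (hp1.comp hφ.tendsto_atTop)
        (fun k => (h (φ k)).abs_le_one x hxc) (hpt x hxc)))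
    rw [mul_assoc]
    refine tendsto_nhds_unique h1 (h2.congr fun k => ?_)
    exact ((h (φ k)).lap_eq x hx).symm
  · have hxc : x ∈ closedBall (0 : E N) 1 := mem_closedBall_zero_iff.2 hx.le
    refine tendsto_nhds_unique (hpt x hxc) ?_
    simp_rw [fun k => (h (φ k)).boundary x hx]
    exact tendsto_const_nhds

end NormalizedSolutions

/-- compactness of a sequence of solutions with bounded `‖u_k‖_∞^{p_k−1}`:
along a subsequence, `‖u_k‖_∞^{p_k−1} → μ > 0` and `u_k/‖u_k‖_∞` converges to an
eigenfunction `ω` with `‖ω‖_∞ = 1`, uniformly on `B̄` and in `C²` on compact subsets of `B`. -/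
theorem stmt_0 (N : ℕ) (hN : 2 ≤ N) (α : ℝ) (hα : 0 ≤ α)
    (p : ℕ → ℝ) (hp : ∀ k, 1 < p k) (hp1 : Tendsto p atTop (𝓝 1))
    (u : ℕ → E N → ℝ) (hsol : ∀ k, IsHenonSol N α (p k) (u k))
    (hnt : ∀ k, ∃ x ∈ closedBall (0 : E N) 1, u k x ≠ 0)
    (hbd : ∃ C : ℝ, ∀ k, supN (u k) ^ (p k - 1) ≤ C) :
    ∃ φ : ℕ → ℕ, StrictMono φ ∧ ∃ (μ : ℝ) (ω : E N → ℝ), 0 < μ ∧ IsEigenfun N α μ ω ∧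
      supN ω = 1 ∧
      Tendsto (fun k => supN (u (φ k)) ^ (p (φ k) - 1)) atTop (𝓝 μ) ∧
      TendstoUniformlyOn (fun k x => u (φ k) x / supN (u (φ k))) ω atTop (closedBall 0 1) ∧
      (∀ K : Set (E N), IsCompact K → K ⊆ ball 0 1 →
        TendstoUniformlyOn (fun k x => u (φ k) x / supN (u (φ k))) ω atTop K ∧
        TendstoUniformlyOn (fun k x => fderiv ℝ (fun y => u (φ k) y / supN (u (φ k))) x)
          (fun x => fderiv ℝ ω x) atTop K ∧
        TendstoUniformlyOn
          (fun k x => fderiv ℝ (fun y => fderiv ℝ (fun w => u (φ k) w / supN (u (φ k))) y) x)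
          (fun x => fderiv ℝ (fun y => fderiv ℝ ω y) x) atTop K) := by
  obtain ⟨C, hC⟩ := hbd
  obtain ⟨φ, hφ, μ, ω, hμ, hω, hsup, hlam, hunif, hder⟩ :=
    exists_subseq_tendsto_eigenfun (by omega) hα hp hp1
      (fun k => Real.rpow_pos_of_pos (supN_pos (hsol k).2.1 (hnt k)) _) hC
      (fun k => (hsol k).isNormalizedSol (hnt k))
  exact ⟨φ, hφ, μ, ω, hμ, hω, hsup, hlam, hunif, fun K hK hKB =>
    ⟨hunif.mono (hKB.trans ball_subset_closedBall), (hder K hK hKB).1, (hder K hK hKB).2⟩⟩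
end
end

section
/- Let N ≥ 2, α ≥ 0, and set ν = (N−2)/(2+α). A real number μ > 0 admits a radial classical eigenfunction of the weighted eigenvalue problem (i.e., an eigenfunction of the form ω(x) = g(|x|)) if and only if μ = ((2+α)/2 · z_i(ν))² for some integer i ≥ 1. Moreover, in that case every radial classical eigenfunction with eigenvalue μ is a constant multiple of the function x ↦ |x|^{−(N−2)/2} J_ν(z_i(ν) |x|^{(2+α)/2}), extended continuously at the origin. -/
open Real MeasureTheory Metric Filter Topology

noncomputable section

/-- The Bessel function of the first kind of order `β`. -/
def besselJ (β r : ℝ) : ℝ :=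
  r ^ β * ∑' k : ℕ,
    ((-1 : ℝ) ^ k / (Nat.factorial k * Real.Gamma ((k : ℝ) + 1 + β))) * (r / 2) ^ (2 * k)

/-- `z` is the `i`-th positive zero of `J_β`: it is a positive zero and `J_β` has
exactly `i − 1` zeros in `(0, z)`. -/
def IsNthZero (β : ℝ) (i : ℕ) (z : ℝ) : Prop :=
  0 < z ∧ besselJ β z = 0 ∧ {r ∈ Set.Ioo 0 z | besselJ β r = 0}.encard = ((i - 1 : ℕ) : ℕ∞)

/-- The `k`-th coefficient of the entire function `besselEntire ν`. -/
def besselCoeff (ν : ℝ) (k : ℕ) : ℝ :=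
  (-1 : ℝ) ^ k / (Nat.factorial k * Real.Gamma ((k : ℝ) + 1 + ν))

/-- The entire function `P` such that `J_ν(r) = r ^ ν * P((r / 2) ^ 2)`. -/
def besselEntire (ν t : ℝ) : ℝ := ∑' k : ℕ, besselCoeff ν k * t ^ k

lemma besselJ_eq (ν r : ℝ) : besselJ ν r = r ^ ν * besselEntire ν ((r / 2) ^ 2) := by
  simp only [besselJ, besselEntire, besselCoeff, pow_mul]

lemma gamma_one_add_le {ν : ℝ} (hν : 0 ≤ ν) (k : ℕ) :
    Real.Gamma (1 + ν) ≤ Real.Gamma ((k : ℝ) + 1 + ν) := by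
  induction k with
  | zero => simp
  | succ k ih =>
    have hpos : 0 < Real.Gamma ((k : ℝ) + 1 + ν) := Real.Gamma_pos_of_pos (by positivity)
    have h1 : Real.Gamma (((k + 1 : ℕ) : ℝ) + 1 + ν)
        = ((k : ℝ) + 1 + ν) * Real.Gamma ((k : ℝ) + 1 + ν) := by
      rw [← Real.Gamma_add_one (by positivity)]
      congr 1
      push_cast
      ring
    rw [h1]
    have : (0 : ℝ) ≤ k := Nat.cast_nonneg k
    nlinarith

lemma norm_besselCoeff_le {ν : ℝ} (hν : 0 ≤ ν) (k : ℕ) :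
    ‖besselCoeff ν k‖ ≤ (Real.Gamma (1 + ν))⁻¹ * (Nat.factorial k : ℝ)⁻¹ := by
  have hpos : 0 < Real.Gamma ((k : ℝ) + 1 + ν) := Real.Gamma_pos_of_pos (by positivity)
  have hpos' : 0 < Real.Gamma (1 + ν) := Real.Gamma_pos_of_pos (by positivity)
  have hle := gamma_one_add_le hν k
  rw [besselCoeff, norm_div, norm_mul, norm_pow, norm_neg, norm_one, one_pow, one_div, mul_inv,
    mul_comm, Real.norm_of_nonneg hpos.le, Real.norm_of_nonneg (by positivity)]
  gcongr

lemma summable_norm_besselCoeff_mul_pow {ν : ℝ} (hν : 0 ≤ ν) {R : ℝ} (hR : 0 ≤ R) :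
    Summable fun k : ℕ => ‖besselCoeff ν k‖ * R ^ k := by
  refine Summable.of_nonneg_of_le (fun k => by positivity) (fun k => ?_)
    ((Real.summable_pow_div_factorial R).mul_left (Real.Gamma (1 + ν))⁻¹)
  calc ‖besselCoeff ν k‖ * R ^ k
      ≤ ((Real.Gamma (1 + ν))⁻¹ * (Nat.factorial k : ℝ)⁻¹) * R ^ k := by
        gcongr
        exact norm_besselCoeff_le hν k
    _ = _ := by ring

lemma summable_besselCoeff {ν : ℝ} (hν : 0 ≤ ν) (t : ℝ) :
    Summable fun k : ℕ => besselCoeff ν k * t ^ k := by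
  refine Summable.of_norm ?_
  simpa only [norm_mul, norm_pow] using summable_norm_besselCoeff_mul_pow hν (norm_nonneg t)

lemma succ_mul_besselCoeff_succ (ν : ℝ) (k : ℕ) :
    ((k : ℝ) + 1) * besselCoeff ν (k + 1) = -besselCoeff (ν + 1) k := by
  have h : (((k + 1 : ℕ) : ℝ) + 1 + ν) = (k : ℝ) + 1 + (ν + 1) := by
    push_cast
    ring
  have hk : (k : ℝ) + 1 ≠ 0 := by positivity
  rw [besselCoeff, besselCoeff, h, Nat.factorial_succ, pow_succ]
  push_cast
  rw [mul_assoc ((k : ℝ) + 1), ← mul_div_assoc, mul_div_mul_left _ _ hk]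
  ring

lemma besselCoeff_recurrence {ν : ℝ} (hν : 0 ≤ ν) (k : ℕ) :
    besselCoeff ν k = ((k : ℝ) + 1 + ν) * besselCoeff (ν + 1) k := by
  have h0 : (k : ℝ) + 1 + ν ≠ 0 := by positivity
  have hpos : 0 < Real.Gamma ((k : ℝ) + 1 + ν) := Real.Gamma_pos_of_pos (by positivity)
  rw [besselCoeff, besselCoeff, ← add_assoc, Real.Gamma_add_one h0]
  field_simp

lemma hasDerivAt_besselEntire {ν : ℝ} (hν : 0 ≤ ν) (t : ℝ) :
    HasDerivAt (besselEntire ν) (-besselEntire (ν + 1) t) t := by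
  have hsplit : besselEntire ν
      = fun s => besselCoeff ν 0 + ∑' k : ℕ, besselCoeff ν (k + 1) * s ^ (k + 1) := by
    funext s
    rw [besselEntire, (summable_besselCoeff hν s).tsum_eq_zero_add]
    simp
  have hderiv : HasDerivAt (fun s => ∑' k : ℕ, besselCoeff ν (k + 1) * s ^ (k + 1))
      (∑' k : ℕ, -(besselCoeff (ν + 1) k * t ^ k)) t := by
    refine hasDerivAt_tsum_of_isPreconnected (t := ball 0 (|t| + 1)) (y₀ := t)
      (summable_norm_besselCoeff_mul_pow (ν := ν + 1) (by positivity) (R := |t| + 1)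
        (by positivity)) isOpen_ball (convex_ball _ _).isPreconnected
      (g' := fun k s => -(besselCoeff (ν + 1) k * s ^ k)) ?_ ?_ ?_ ?_ ?_
    · intro k s _
      refine ((hasDerivAt_pow (k + 1) s).const_mul (besselCoeff ν (k + 1))).congr_deriv ?_
      have := succ_mul_besselCoeff_succ ν k
      push_cast
      linear_combination s ^ k * this
    · intro k s hs
      rw [norm_neg, norm_mul, norm_pow]
      have : ‖s‖ ≤ |t| + 1 := (mem_ball_zero_iff.1 hs).le
      gcongr
    · simp
    · exact (summable_nat_add_iff 1).2 (summable_besselCoeff hν t)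
    · simp
  rw [hsplit]
  refine (hderiv.const_add (besselCoeff ν 0)).congr_deriv ?_
  rw [tsum_neg, besselEntire]

/-- The second-order differential equation of `besselEntire ν`, written through shifts of the
order, which are derivatives up to sign by `hasDerivAt_besselEntire`. -/
lemma besselEntire_ode {ν : ℝ} (hν : 0 ≤ ν) (t : ℝ) :
    t * besselEntire (ν + 2) t - (ν + 1) * besselEntire (ν + 1) t + besselEntire ν t = 0 := by
  have s0 := summable_besselCoeff hν t
  have s1 := summable_besselCoeff (ν := ν + 1) (by positivity) t
  have s2 := summable_besselCoeff (ν := ν + 2) (by positivity) t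
  have hsub : besselEntire ν t - (ν + 1) * besselEntire (ν + 1) t
      = ∑' k : ℕ, (k : ℝ) * besselCoeff (ν + 1) k * t ^ k := by
    rw [besselEntire, besselEntire, ← tsum_mul_left, ← s0.tsum_sub (s1.mul_left (ν + 1))]
    refine tsum_congr fun k => ?_
    rw [besselCoeff_recurrence hν k]
    ring
  have hsum : Summable fun k : ℕ => (k : ℝ) * besselCoeff (ν + 1) k * t ^ k := by
    refine (s0.sub (s1.mul_left (ν + 1))).congr fun k => ?_
    rw [besselCoeff_recurrence hν k]
    ring
  have hshift : t * besselEntire (ν + 2) t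
      = -∑' k : ℕ, (k : ℝ) * besselCoeff (ν + 1) k * t ^ k := by
    rw [hsum.tsum_eq_zero_add, besselEntire, ← tsum_mul_left, Nat.cast_zero, zero_mul, zero_mul,
      zero_add, ← tsum_neg]
    refine tsum_congr fun k => ?_
    have := succ_mul_besselCoeff_succ (ν + 1) k
    rw [show ν + 1 + 1 = ν + 2 by ring] at this
    push_cast
    rw [this]
    ring
  linarith

lemma besselEntire_zero_ne_zero {ν : ℝ} (hν : 0 ≤ ν) : besselEntire ν 0 ≠ 0 := by
  have hpos : 0 < Real.Gamma (1 + ν) := Real.Gamma_pos_of_pos (by positivity)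
  have h : besselEntire ν 0 = (Real.Gamma (1 + ν))⁻¹ := by
    rw [besselEntire, tsum_eq_single 0]
    · simp [besselCoeff]
    · intro k hk
      simp [hk]
  rw [h]
  positivity

lemma analyticOnNhd_besselEntire {ν : ℝ} (hν : 0 ≤ ν) :
    AnalyticOnNhd ℝ (besselEntire ν) Set.univ := by
  let p := FormalMultilinearSeries.ofScalars ℝ (besselCoeff ν)
  have hrad : p.radius = ⊤ := by
    refine p.radius_eq_top_of_summable_norm fun r => ?_
    refine (summable_norm_besselCoeff_mul_pow hν r.2).congr fun k => ?_
    rw [FormalMultilinearSeries.ofScalars_norm]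
    rfl
  have hsum : p.sum = besselEntire ν := by
    funext t
    simp [p, FormalMultilinearSeries.sum, besselEntire,
      mul_comm]
  have h := p.hasFPowerSeriesOnBall (by rw [hrad]; exact ENNReal.coe_lt_top)
  rw [hrad, hsum] at h
  intro t _
  exact h.analyticAt_of_mem (by simp)

lemma finite_zeros_besselEntire {ν : ℝ} (hν : 0 ≤ ν) (a b : ℝ) :
    {t ∈ Set.Icc a b | besselEntire ν t = 0}.Finite := by
  by_contra hinf
  obtain ⟨x, -, hx⟩ := Set.Infinite.exists_accPt_of_subset_isCompact hinf
    (isCompact_Icc (a := a) (b := b)) (fun t ht => ht.1)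
  rw [accPt_iff_frequently_nhdsNE] at hx
  have h := (analyticOnNhd_besselEntire hν).eqOn_zero_of_preconnected_of_frequently_eq_zero
    isPreconnected_univ (Set.mem_univ x) (hx.mono fun t ht => ht.2)
  exact besselEntire_zero_ne_zero hν (h (Set.mem_univ 0))

lemma finite_zeros_besselJ {ν : ℝ} (hν : 0 ≤ ν) (z : ℝ) :
    {r ∈ Set.Ioo 0 z | besselJ ν r = 0}.Finite := by
  refine Set.Finite.of_finite_image (f := fun r => (r / 2) ^ 2)
    ((finite_zeros_besselEntire hν 0 ((z / 2) ^ 2)).subset ?_) ?_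
  · rintro _ ⟨r, ⟨⟨hr0, hrz⟩, hr⟩, rfl⟩
    refine ⟨⟨by positivity, ?_⟩, ?_⟩
    · change (r / 2) ^ 2 ≤ (z / 2) ^ 2
      gcongr
    rw [besselJ_eq] at hr
    exact (mul_eq_zero.1 hr).resolve_left (Real.rpow_pos_of_pos hr0 ν).ne'
  · rintro r ⟨⟨hr0, -⟩, -⟩ s ⟨⟨hs0, -⟩, -⟩ h
    have := (sq_eq_sq₀ (by positivity) (by positivity)).1 h
    linarith

/-- Every positive zero of `J_ν` is the `i`-th one for some `i`. -/
lemma exists_isNthZero {ν : ℝ} (hν : 0 ≤ ν) {z : ℝ} (hz : 0 < z) (h : besselJ ν z = 0) :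
    ∃ i : ℕ, 1 ≤ i ∧ IsNthZero ν i z := by
  refine ⟨{r ∈ Set.Ioo 0 z | besselJ ν r = 0}.ncard + 1, by omega, hz, h, ?_⟩
  rw [Nat.add_sub_cancel, (finite_zeros_besselJ hν z).cast_ncard_eq]

lemma hasFDerivAt_norm_rpow_smul {V : Type*} [NormedAddCommGroup V] [InnerProductSpace ℝ V]
    {α : ℝ} (hα : 0 < α) (x : V) :
    HasFDerivAt (fun y : V => ‖y‖ ^ α • y)
      (‖x‖ ^ α • ContinuousLinearMap.id ℝ V
        + ((α * ‖x‖ ^ (α - 2)) • innerSL ℝ x).smulRight x) x := by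
  by_cases hx : x = 0
  · subst hx
    have hlim : Tendsto (fun y : V => ‖y‖ ^ α) (𝓝 0) (𝓝 0) := by
      have h : ContinuousAt (fun y : V => ‖y‖ ^ α) 0 :=
        continuousAt_id.norm.rpow_const (.inr hα.le)
      simpa [ContinuousAt, hα.ne'] using h
    refine .of_isLittleO ?_
    simp only [norm_zero, smul_zero, sub_zero, Real.zero_rpow hα.ne', zero_smul, zero_add,
      ContinuousLinearMap.smulRight_zero, zero_apply]
    have := (Asymptotics.isLittleO_one_iff ℝ).2 hlim |>.smul_isBigO
      (Asymptotics.isBigO_refl (fun y : V => y) (𝓝 0))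
    simpa using this
  · have h1 : HasFDerivAt (fun y : V => ‖y‖ ^ α) ((α * ‖x‖ ^ (α - 2)) • innerSL ℝ x) x := by
      apply HasStrictFDerivAt.hasFDerivAt
      convert! (hasStrictFDerivAt_norm_sq x).rpow_const (p := α / 2) (by simp [hx]) using 0
      simp_rw [← Real.rpow_natCast_mul (norm_nonneg _), ← Nat.cast_smul_eq_nsmul ℝ, smul_smul]
      ring_nf
    exact h1.smul (hasFDerivAt_id x)

lemma contDiff_norm_rpow_smul {V : Type*} [NormedAddCommGroup V] [InnerProductSpace ℝ V]
    {α : ℝ} (hα : 0 ≤ α) : ContDiff ℝ 1 (fun y : V => ‖y‖ ^ α • y) := by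
  rcases hα.eq_or_lt with rfl | hα
  · simpa using contDiff_fun_id
  refine contDiff_one_iff_hasFDerivAt.2 ⟨_, ?_, hasFDerivAt_norm_rpow_smul hα⟩
  refine (continuous_norm.rpow_const fun _ => .inr hα.le).smul continuous_const |>.add ?_
  rw [continuous_iff_continuousAt]
  intro x
  by_cases hx : x = 0
  · subst hx
    simp only [ContinuousAt, ContinuousLinearMap.smulRight_zero]
    rw [tendsto_zero_iff_norm_tendsto_zero]
    have hlim : Tendsto (fun y : V => α * ‖y‖ ^ α) (𝓝 0) (𝓝 0) := by
      have h : ContinuousAt (fun y : V => α * ‖y‖ ^ α) 0 :=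
        (continuousAt_id.norm.rpow_const (.inr hα.le)).const_mul α
      simpa [ContinuousAt, hα.ne'] using h
    refine squeeze_zero (fun _ => norm_nonneg _) (fun y => ?_) hlim
    rcases eq_or_ne y 0 with rfl | hy
    · simp [hα.ne']
    · have hy' : 0 < ‖y‖ := norm_pos_iff.2 hy
      rw [ContinuousLinearMap.norm_smulRight_apply, norm_smul, innerSL_apply_norm,
        Real.norm_of_nonneg (by positivity), Real.rpow_sub hy']
      apply le_of_eq
      rw [Real.rpow_two]
      field_simp
  · have h0 : ‖x‖ ≠ 0 ∨ 0 ≤ α - 2 := .inl (norm_ne_zero_iff.2 hx)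
    have h1 : ContinuousAt (fun y : V => (α * ‖y‖ ^ (α - 2)) • innerSL ℝ y) x :=
      ((continuousAt_id.norm.rpow_const h0).const_mul α).smul (innerSL ℝ).continuous.continuousAt
    exact (ContinuousLinearMap.smulRightL ℝ V V).continuous₂.continuousAt.comp
      (h1.prodMk continuousAt_id)

/-- The function `x ↦ ‖x‖ ^ p` is twice continuously differentiable when `2 ≤ p`. -/
lemma contDiff_two_norm_rpow {V : Type*} [NormedAddCommGroup V] [InnerProductSpace ℝ V]
    {p : ℝ} (hp : 2 ≤ p) : ContDiff ℝ 2 (fun y : V => ‖y‖ ^ p) := by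
  rw [show (2 : WithTop ℕ∞) = 1 + 1 from rfl, contDiff_succ_iff_fderiv]
  refine ⟨differentiable_norm_rpow (by linarith), by simp, ?_⟩
  have h : fderiv ℝ (fun y : V => ‖y‖ ^ p)
      = fun y => p • innerSL ℝ (‖y‖ ^ (p - 2) • y) := by
    funext y
    rw [fderiv_norm_rpow y (by linarith), map_smul, smul_smul]
  rw [h]
  exact ((innerSL ℝ).contDiff.comp (contDiff_norm_rpow_smul (by linarith))).const_smul p

/-- The Laplacian of a radial function away from the origin. -/
lemma lap_eq_of_radial {N : ℕ} {u : E N → ℝ} {x : E N} (hx : x ≠ 0) {h h₁ : ℝ → ℝ} {h₂ : ℝ}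
    (hu : ∀ᶠ y in 𝓝 x, u y = h ‖y‖) (hh : ∀ᶠ r in 𝓝 ‖x‖, HasDerivAt h (h₁ r) r)
    (hh₁ : HasDerivAt h₁ h₂ ‖x‖) :
    lap u x = h₂ + ((N : ℝ) - 1) / ‖x‖ * h₁ ‖x‖ := by
  have hnorm : ∀ y : E N, y ≠ 0 → HasFDerivAt (fun y : E N => ‖y‖) (‖y‖⁻¹ • innerSL ℝ y) y := by
    intro y hy
    have := (hasStrictFDerivAt_norm_sq y).hasFDerivAt.sqrt (by simp [hy])
    simp only [Real.sqrt_sq (norm_nonneg _)] at this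
    convert! this using 1
    ext v
    simp
    field_simp
  have hx' : ‖x‖ ≠ 0 := norm_ne_zero_iff.2 hx
  have hinner : ∀ (y : E N) (i : Fin N), inner ℝ y (EuclideanSpace.single i 1) = y i := by
    intro y i
    simp [EuclideanSpace.inner_single_right]
  have hgrad : ∀ i : Fin N, (fun y => fderiv ℝ u y (EuclideanSpace.single i 1))
      =ᶠ[𝓝 x] fun y => h₁ ‖y‖ * (‖y‖⁻¹ * y i) := by
    intro i
    filter_upwards [hu.eventually_nhds, continuous_norm.continuousAt.eventually hh,
      isOpen_ne.mem_nhds hx] with y hy hhy hy0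
    have h1 : HasFDerivAt u (h₁ ‖y‖ • (‖y‖⁻¹ • innerSL ℝ y)) y :=
      (hhy.comp_hasFDerivAt y (hnorm y hy0)).congr_of_eventuallyEq hy
    rw [h1.fderiv]
    simp [hinner]
  have hsecond : ∀ i : Fin N, fderiv ℝ (fun y => fderiv ℝ u y (EuclideanSpace.single i 1)) x
      (EuclideanSpace.single i 1)
      = (h₂ / ‖x‖ ^ 2 - h₁ ‖x‖ / ‖x‖ ^ 3) * x i ^ 2 + h₁ ‖x‖ / ‖x‖ := by
    intro i
    have hcoord : HasFDerivAt (fun y : E N => y i) (EuclideanSpace.proj i : E N →L[ℝ] ℝ) x :=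
      (EuclideanSpace.proj i : E N →L[ℝ] ℝ).hasFDerivAt
    have h1 : HasFDerivAt (fun y : E N => h₁ ‖y‖) (h₂ • (‖x‖⁻¹ • innerSL ℝ x)) x :=
      hh₁.comp_hasFDerivAt x (hnorm x hx)
    have h2 : HasFDerivAt (fun y : E N => ‖y‖⁻¹)
        ((-(‖x‖ ^ 2)⁻¹) • (‖x‖⁻¹ • innerSL ℝ x)) x :=
      (hasDerivAt_inv hx').comp_hasFDerivAt x (hnorm x hx)
    rw [(hgrad i).fderiv_eq, (h1.fun_mul (h2.fun_mul hcoord)).fderiv]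
    simp [hinner]
    field_simp
    ring
  have hsq : ∑ i : Fin N, x i ^ 2 = ‖x‖ ^ 2 := by
    rw [EuclideanSpace.norm_sq_eq]
    simp
  rw [lap, Finset.sum_congr rfl fun i _ => hsecond i, Finset.sum_add_distrib, ← Finset.mul_sum,
    hsq]
  simp
  field_simp
  ring

lemma ContDiffOn.contDiffOn_fderiv_apply {N : ℕ} {u : E N → ℝ} {s : Set (E N)}
    (hs : IsOpen s) (hu : ContDiffOn ℝ 2 u s) (v : E N) :
    ContDiffOn ℝ 1 (fun y => fderiv ℝ u y v) s :=
  (hu.fderiv_of_isOpen hs (m := 1) (by norm_num)).clm_apply contDiffOn_const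

lemma continuousOn_lap {N : ℕ} {u : E N → ℝ} {s : Set (E N)} (hs : IsOpen s)
    (hu : ContDiffOn ℝ 2 u s) : ContinuousOn (lap u) s := by
  refine continuousOn_finsetSum _ fun i _ => ?_
  exact ((hu.contDiffOn_fderiv_apply hs _).continuousOn_fderiv_of_isOpen hs le_rfl).clm_apply
    continuousOn_const

lemma lap_sub_const_mul {N : ℕ} {u v : E N → ℝ} {s : Set (E N)} (hs : IsOpen s)
    (hu : ContDiffOn ℝ 2 u s) (hv : ContDiffOn ℝ 2 v s) (c : ℝ) {x : E N} (hx : x ∈ s) :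
    lap (fun y => u y - c * v y) x = lap u x - c * lap v x := by
  rw [lap, lap, lap, Finset.mul_sum, ← Finset.sum_sub_distrib]
  refine Finset.sum_congr rfl fun i _ => ?_
  have hdiff {w : E N → ℝ} (hw : ContDiffOn ℝ 2 w s) {y : E N} (hy : y ∈ s) :
      DifferentiableAt ℝ w y :=
    (hw.contDiffAt (hs.mem_nhds hy)).differentiableAt (by norm_num)
  have hdiff' {w : E N → ℝ} (hw : ContDiffOn ℝ 2 w s) :
      DifferentiableAt ℝ (fun y => fderiv ℝ w y (EuclideanSpace.single i 1)) x :=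
    ((hw.contDiffOn_fderiv_apply hs _).contDiffAt (hs.mem_nhds hx)).differentiableAt (by norm_num)
  have h1 : (fun y => fderiv ℝ (fun y => u y - c * v y) y (EuclideanSpace.single i 1))
      =ᶠ[𝓝 x] fun y => fderiv ℝ u y (EuclideanSpace.single i 1)
        - c * fderiv ℝ v y (EuclideanSpace.single i 1) := by
    filter_upwards [hs.mem_nhds hx] with y hy
    rw [((hdiff hu hy).hasFDerivAt.fun_sub ((hdiff hv hy).hasFDerivAt.const_mul c)).fderiv]
    simp
  rw [h1.fderiv_eq,
    ((hdiff' hu).hasFDerivAt.fun_sub ((hdiff' hv).hasFDerivAt.const_mul c)).fderiv]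
  simp

/-- A solution of `w₂ + q(r) w₁ + V(r) w = 0` on `(0, 1)` with `q ≥ 0`, `|V| ≤ K` and vanishing
Cauchy data at the (possibly singular) point `0` is zero. -/
lemma eq_zero_of_singular_ode {w w₁ w₂ q V : ℝ → ℝ} {K : ℝ}
    (hw : ∀ r ∈ Set.Ioo (-1 : ℝ) 1, HasDerivAt w (w₁ r) r)
    (hw₁ : ∀ r ∈ Set.Ioo (-1 : ℝ) 1, HasDerivAt w₁ (w₂ r) r)
    (h0 : w 0 = 0) (h1 : w₁ 0 = 0)
    (hq : ∀ r ∈ Set.Ioo (0 : ℝ) 1, 0 ≤ q r) (hV : ∀ r ∈ Set.Ioo (0 : ℝ) 1, |V r| ≤ K)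
    (hode : ∀ r ∈ Set.Ioo (0 : ℝ) 1, w₂ r + q r * w₁ r + V r * w r = 0) :
    ∀ r ∈ Set.Ico (0 : ℝ) 1, w r = 0 := by
  let F : ℝ → ℝ := fun r => (w r ^ 2 + w₁ r ^ 2) * Real.exp (-(1 + K) * r)
  have hF : ∀ r ∈ Set.Ioo (-1 : ℝ) 1, HasDerivAt F
      ((2 * w r * w₁ r + 2 * w₁ r * w₂ r - (1 + K) * (w r ^ 2 + w₁ r ^ 2))
        * Real.exp (-(1 + K) * r)) r := by
    intro r hr
    have he : HasDerivAt (fun r => Real.exp (-(1 + K) * r))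
        (Real.exp (-(1 + K) * r) * (-(1 + K) * 1)) r :=
      ((hasDerivAt_id r).const_mul (-(1 + K))).exp
    refine ((((hw r hr).pow 2).add ((hw₁ r hr).pow 2)).mul he).congr_deriv ?_
    simp
    ring
  have hanti : AntitoneOn F (Set.Ico 0 1) := by
    refine antitoneOn_of_deriv_nonpos (convex_Ico 0 1) ?_ ?_ ?_
    · exact fun r hr => (hF r ⟨by linarith [hr.1], hr.2⟩).continuousAt.continuousWithinAt
    · rw [interior_Ico]
      exact fun r hr =>
        (hF r ⟨by linarith [hr.1], hr.2⟩).differentiableAt.differentiableWithinAt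
    · rw [interior_Ico]
      intro r hr
      rw [(hF r ⟨by linarith [hr.1], hr.2⟩).deriv]
      refine mul_nonpos_of_nonpos_of_nonneg ?_ (Real.exp_pos _).le
      have hw2 : w₂ r = -(q r * w₁ r) - V r * w r := by linarith [hode r hr]
      have hVr := abs_le.1 (hV r hr)
      rw [hw2]
      nlinarith [mul_nonneg (hq r hr) (sq_nonneg (w₁ r)), sq_nonneg (w r - w₁ r),
        mul_nonneg (sub_nonneg.2 hVr.2) (sq_nonneg (w r - w₁ r)),
        mul_nonneg (neg_le_iff_add_nonneg.1 hVr.1) (sq_nonneg (w r + w₁ r)),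
        mul_nonneg (sub_nonneg.2 hVr.2) (sq_nonneg (w r + w₁ r)),
        mul_nonneg (neg_le_iff_add_nonneg.1 hVr.1) (sq_nonneg (w r - w₁ r))]
  intro r hr
  have h := hanti (by simp) hr hr.1
  have hF0 : F 0 = 0 := by simp [F, h0, h1]
  rw [hF0] at h
  have hle : w r ^ 2 + w₁ r ^ 2 ≤ 0 := nonpos_of_mul_nonpos_left h (Real.exp_pos _)
  have : w r ^ 2 = 0 := by nlinarith [sq_nonneg (w r), sq_nonneg (w₁ r)]
  exact pow_eq_zero_iff (two_ne_zero) |>.1 this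

/-- A radial solution of `-Δu = μ |x| ^ α u` in the unit ball vanishing at the origin is zero. -/
lemma eq_zero_of_radial {N : ℕ} (hN : 2 ≤ N) {α μ : ℝ} (hα : 0 ≤ α) {u : E N → ℝ}
    {g : ℝ → ℝ} (hu : ContDiffOn ℝ 2 u (ball 0 1)) (hg : ∀ x ∈ ball (0 : E N) 1, u x = g ‖x‖)
    (heq : ∀ x ∈ ball (0 : E N) 1, -lap u x = μ * ‖x‖ ^ α * u x) (h0 : u 0 = 0) :
    ∀ x ∈ ball (0 : E N) 1, u x = 0 := by
  let e : E N := EuclideanSpace.single ⟨0, by omega⟩ 1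
  have he : ‖e‖ = 1 := by simp [e]
  let w : ℝ → ℝ := fun r => u (r • e)
  have hmem : ∀ r ∈ Set.Ioo (-1 : ℝ) 1, r • e ∈ ball (0 : E N) 1 := by
    intro r hr
    rw [mem_ball_zero_iff, norm_smul, he, mul_one, Real.norm_eq_abs]
    exact abs_lt.2 hr
  have hwC : ContDiffOn ℝ 2 w (Set.Ioo (-1) 1) :=
    hu.comp (contDiff_id.smul contDiff_const).contDiffOn hmem
  have hw1C : ContDiffOn ℝ 1 (deriv w) (Set.Ioo (-1) 1) :=
    hwC.deriv_of_isOpen isOpen_Ioo (by norm_num)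
  have hw : ∀ r ∈ Set.Ioo (-1 : ℝ) 1, HasDerivAt w (deriv w r) r := fun r hr =>
    ((hwC.contDiffAt (isOpen_Ioo.mem_nhds hr)).differentiableAt (by norm_num)).hasDerivAt
  have hw1 : ∀ r ∈ Set.Ioo (-1 : ℝ) 1, HasDerivAt (deriv w) (deriv (deriv w) r) r := fun r hr =>
    ((hw1C.contDiffAt (isOpen_Ioo.mem_nhds hr)).differentiableAt (by norm_num)).hasDerivAt
  have hgw : ∀ y ∈ ball (0 : E N) 1, u y = w ‖y‖ := by
    intro y hy
    have hy' := mem_ball_zero_iff.1 hy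
    simp only [w]
    rw [hg y hy, hg _ (hmem ‖y‖ ⟨by linarith [norm_nonneg y], hy'⟩), norm_smul, he, mul_one,
      norm_norm]
  have hzero : (0 : ℝ) ∈ Set.Ioo (-1 : ℝ) 1 := by norm_num
  have hd0 : deriv w 0 = 0 := by
    have heven : (fun r => w (-r)) =ᶠ[𝓝 0] w := by
      filter_upwards [isOpen_Ioo.mem_nhds hzero] with r hr
      simp only [w]
      rw [hg _ (hmem r hr), neg_smul, hg _ (by simpa using hmem r hr), norm_neg]
    have h1 := heven.deriv_eq
    rw [deriv_comp_neg, neg_zero] at h1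
    linarith
  have hode : ∀ r ∈ Set.Ioo (0 : ℝ) 1,
      deriv (deriv w) r + ((N : ℝ) - 1) / r * deriv w r + (μ * r ^ α) * w r = 0 := by
    intro r hr
    have hr' : r ∈ Set.Ioo (-1 : ℝ) 1 := ⟨by linarith [hr.1], hr.2⟩
    have hnorm : ‖r • e‖ = r := by
      rw [norm_smul, he, mul_one, Real.norm_of_nonneg hr.1.le]
    have hne : r • e ≠ 0 := norm_pos_iff.1 (by rw [hnorm]; exact hr.1)
    have hl := lap_eq_of_radial (u := u) (x := r • e) hne (h := w) (h₁ := deriv w)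
      (h₂ := deriv (deriv w) r) ?_ ?_ ?_
    · have := heq _ (hmem r hr')
      rw [hl, hnorm] at this
      change -_ = μ * r ^ α * w r at this
      linarith
    · filter_upwards [isOpen_ball.mem_nhds (hmem r hr')] with y hy using hgw y hy
    · rw [hnorm]
      filter_upwards [isOpen_Ioo.mem_nhds hr'] with s hs using hw s hs
    · rw [hnorm]
      exact hw1 r hr'
  have hN' : (2 : ℝ) ≤ N := by exact_mod_cast hN
  have hres := eq_zero_of_singular_ode (K := |μ|) hw hw1 (by simpa [w] using h0) hd0
    (fun r hr => div_nonneg (by linarith) hr.1.le) (fun r hr => ?_) hode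
  · intro x hx
    rw [hgw x hx]
    exact hres _ ⟨norm_nonneg x, mem_ball_zero_iff.1 hx⟩
  · rw [abs_mul, abs_of_nonneg (Real.rpow_nonneg hr.1.le α)]
    exact mul_le_of_le_one_right (abs_nonneg μ) (Real.rpow_le_one hr.1.le hr.2.le hα)

/-- The radial solution of `-Δu = μ |x| ^ α u` that is regular at the origin. -/
def radialSol (N : ℕ) (α μ : ℝ) (x : E N) : ℝ :=
  besselEntire (((N : ℝ) - 2) / (2 + α)) (μ / (2 + α) ^ 2 * ‖x‖ ^ (2 + α))

lemma order_nonneg {N : ℕ} (hN : 2 ≤ N) {α : ℝ} (hα : 0 ≤ α) :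
    0 ≤ ((N : ℝ) - 2) / (2 + α) := by
  have hN' : (2 : ℝ) ≤ N := by exact_mod_cast hN
  exact div_nonneg (by linarith) (by linarith)

lemma contDiff_radialSol {N : ℕ} (hN : 2 ≤ N) {α : ℝ} (hα : 0 ≤ α) (μ : ℝ) :
    ContDiff ℝ 2 (radialSol N α μ) := by
  have h : ContDiff ℝ 2 (besselEntire (((N : ℝ) - 2) / (2 + α))) :=
    (analyticOnNhd_besselEntire (order_nonneg hN hα)).contDiff
  exact h.comp (contDiff_const.mul (contDiff_two_norm_rpow (by linarith)))

lemma radialSol_zero_ne_zero {N : ℕ} (hN : 2 ≤ N) {α : ℝ} (hα : 0 ≤ α) (μ : ℝ) :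
    radialSol N α μ 0 ≠ 0 := by
  have h : (2 : ℝ) + α ≠ 0 := by positivity
  simpa [radialSol, h] using besselEntire_zero_ne_zero (order_nonneg hN hα)

lemma lap_radialSol_of_ne_zero {N : ℕ} (hN : 2 ≤ N) {α : ℝ} (hα : 0 ≤ α) (μ : ℝ) {x : E N}
    (hx : x ≠ 0) : -lap (radialSol N α μ) x = μ * ‖x‖ ^ α * radialSol N α μ x := by
  have hν := order_nonneg hN hα
  have hx' : 0 < ‖x‖ := norm_pos_iff.2 hx
  have hp : 2 + α ≠ 0 := by positivity
  set ν := ((N : ℝ) - 2) / (2 + α) with hνdef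
  set c := μ / (2 + α) ^ 2 with hc
  have hN : (N : ℝ) = ν * (2 + α) + 2 := by
    rw [hνdef]
    field_simp
    ring
  have hμ : μ = c * (2 + α) ^ 2 := by
    rw [hc]
    field_simp
  clear_value ν c
  have hs : ∀ r : ℝ, 0 < r →
      HasDerivAt (fun r : ℝ => c * r ^ (2 + α)) (c * ((2 + α) * r ^ (1 + α))) r := by
    intro r hr
    refine ((Real.hasDerivAt_rpow_const (.inl hr.ne')).const_mul c).congr_deriv ?_
    rw [show 2 + α - 1 = 1 + α by ring]
  have h1 : ∀ r : ℝ, 0 < r → HasDerivAt (fun r : ℝ => besselEntire ν (c * r ^ (2 + α)))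
      (-besselEntire (ν + 1) (c * r ^ (2 + α)) * (c * ((2 + α) * r ^ (1 + α)))) r := fun r hr =>
    (hasDerivAt_besselEntire hν _).comp r (hs r hr)
  have h2 := ((hasDerivAt_besselEntire (ν := ν + 1) (by positivity) _).comp ‖x‖
    (hs ‖x‖ hx')).neg.mul
    (((Real.hasDerivAt_rpow_const (p := 1 + α) (.inl hx'.ne')).const_mul (2 + α)).const_mul c)
  have hl := lap_eq_of_radial (u := radialSol N α μ) hx
    (Eventually.of_forall fun y => by rw [radialSol, ← hνdef, ← hc])
    ((eventually_gt_nhds hx').mono h1) h2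
  have hode := besselEntire_ode hν (c * ‖x‖ ^ (2 + α))
  rw [hl, radialSol, ← hνdef, ← hc, hμ, hN, show 1 + α - 1 = α by ring,
    show ν + 1 + 1 = ν + 2 by ring]
  have e1 : ‖x‖ ^ (1 + α) = ‖x‖ * ‖x‖ ^ α := by
    rw [Real.rpow_add hx', Real.rpow_one]
  have e2 : ‖x‖ ^ (2 + α) = ‖x‖ ^ 2 * ‖x‖ ^ α := by
    rw [Real.rpow_add hx', Real.rpow_two]
  simp only [Function.comp_apply, Pi.neg_apply]
  rw [e2] at hode ⊢
  rw [e1]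
  rw [div_eq_mul_inv]
  linear_combination (-(c * (2 + α) ^ 2 * ‖x‖ ^ α)) * hode
    + ((ν * (2 + α) + 1) * c * (2 + α) * ‖x‖ ^ α
      * besselEntire (ν + 1) (c * (‖x‖ ^ 2 * ‖x‖ ^ α))) * mul_inv_cancel₀ hx'.ne'

lemma lap_radialSol {N : ℕ} (hN : 2 ≤ N) {α : ℝ} (hα : 0 ≤ α) (μ : ℝ) (x : E N) :
    -lap (radialSol N α μ) x = μ * ‖x‖ ^ α * radialSol N α μ x := by
  have hC := contDiff_radialSol hN hα μ
  have h1 : Continuous fun x : E N => -lap (radialSol N α μ) x :=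
    (continuousOn_univ.1 (continuousOn_lap isOpen_univ hC.contDiffOn)).neg
  have h2 : Continuous fun x : E N => μ * ‖x‖ ^ α * radialSol N α μ x :=
    (continuous_const.mul (continuous_norm.rpow_const fun _ => .inr hα)).mul hC.continuous
  have : Nontrivial (E N) := by
    have : Nonempty (Fin N) := ⟨⟨0, by omega⟩⟩
    infer_instance
  exact congrFun (h1.ext_on (dense_compl_singleton (0 : E N)) h2
    fun y hy => lap_radialSol_of_ne_zero hN hα μ hy) x

/-- Every radial eigenfunction is a nonzero multiple of `radialSol`. -/
lemma exists_eq_mul_radialSol {N : ℕ} (hN : 2 ≤ N) {α μ : ℝ} (hα : 0 ≤ α) {ω : E N → ℝ}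
    (hω : IsEigenfun N α μ ω) {g : ℝ → ℝ} (hg : ∀ x ∈ closedBall (0 : E N) 1, ω x = g ‖x‖) :
    ∃ C : ℝ, C ≠ 0 ∧ ∀ x ∈ closedBall (0 : E N) 1, ω x = C * radialSol N α μ x := by
  obtain ⟨hC2, hcont, ⟨x₀, hx₀, hx₀ne⟩, heq, -⟩ := hω
  have hR := contDiff_radialSol hN hα μ
  have h0 := radialSol_zero_ne_zero hN hα μ
  set C := ω 0 / radialSol N α μ 0 with hC
  have hball : ∀ x ∈ ball (0 : E N) 1, ω x - C * radialSol N α μ x = 0 := by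
    refine eq_zero_of_radial (α := α) (μ := μ) hN hα
      (g := fun r => g r - C * besselEntire (((N : ℝ) - 2) / (2 + α))
        (μ / (2 + α) ^ 2 * r ^ (2 + α)))
      (hC2.sub (contDiff_const.mul hR).contDiffOn) ?_ ?_ ?_
    · intro x hx
      rw [hg x (ball_subset_closedBall hx), radialSol]
    · intro x hx
      rw [lap_sub_const_mul isOpen_ball hC2 hR.contDiffOn C hx]
      linear_combination heq x hx - C * lap_radialSol hN hα μ x
    · rw [hC, div_mul_cancel₀ _ h0, sub_self]
  have hclosed : Set.EqOn ω (fun x => C * radialSol N α μ x) (closedBall 0 1) := by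
    refine Set.EqOn.of_subset_closure (s := ball 0 1) (fun x hx => sub_eq_zero.1 (hball x hx))
      hcont (continuous_const.mul hR.continuous).continuousOn ball_subset_closedBall ?_
    rw [closure_ball _ one_ne_zero]
  refine ⟨C, ?_, hclosed⟩
  intro hC0
  apply hx₀ne
  simp [hclosed hx₀, hC0]

lemma radialSol_eq_besselEntire {N : ℕ} {α z : ℝ} (hα : 0 ≤ α) (x : E N) :
    radialSol N α (((2 + α) / 2 * z) ^ 2) x
      = besselEntire (((N : ℝ) - 2) / (2 + α)) ((z * ‖x‖ ^ ((2 + α) / 2) / 2) ^ 2) := by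
  have hp : 2 + α ≠ 0 := by positivity
  have hsq : (‖x‖ ^ ((2 + α) / 2)) ^ 2 = ‖x‖ ^ (2 + α) := by
    rw [← Real.rpow_mul_natCast (norm_nonneg x)]
    norm_num
  rw [radialSol, ← hsq]
  congr 1
  field_simp

lemma radialSol_eq_besselJ {N : ℕ} {α z : ℝ} (hα : 0 ≤ α) (hz : 0 < z) {x : E N} (hx : x ≠ 0) :
    radialSol N α (((2 + α) / 2 * z) ^ 2) x
      = z ^ (-(((N : ℝ) - 2) / (2 + α))) * (‖x‖ ^ (-(((N : ℝ) - 2) / 2)) *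
        besselJ (((N : ℝ) - 2) / (2 + α)) (z * ‖x‖ ^ ((2 + α) / 2))) := by
  have hp : 2 + α ≠ 0 := by positivity
  have hx' : 0 < ‖x‖ := norm_pos_iff.2 hx
  rw [radialSol_eq_besselEntire hα, besselJ_eq, Real.mul_rpow hz.le (by positivity),
    ← Real.rpow_mul hx'.le, Real.rpow_neg hz.le, Real.rpow_neg hx'.le,
    show (2 + α) / 2 * (((N : ℝ) - 2) / (2 + α)) = ((N : ℝ) - 2) / 2 by field_simp]
  have h1 := (Real.rpow_pos_of_pos hz (((N : ℝ) - 2) / (2 + α))).ne'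
  have h2 := (Real.rpow_pos_of_pos hx' (((N : ℝ) - 2) / 2)).ne'
  field_simp

lemma radialSol_eq_zero_iff {N : ℕ} {α z : ℝ} (hα : 0 ≤ α) (hz : 0 < z) {x : E N}
    (hx : ‖x‖ = 1) :
    radialSol N α (((2 + α) / 2 * z) ^ 2) x = 0 ↔ besselJ (((N : ℝ) - 2) / (2 + α)) z = 0 := by
  have hx0 : x ≠ 0 := norm_pos_iff.1 (by rw [hx]; exact one_pos)
  rw [radialSol_eq_besselJ hα hz hx0]
  simp [hx, (Real.rpow_pos_of_pos hz _).ne']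

theorem stmt_2 (N : ℕ) (hN : 2 ≤ N) (α : ℝ) (hα : 0 ≤ α) (μ : ℝ) (hμ : 0 < μ) :
    ((∃ ω : E N → ℝ, IsEigenfun N α μ ω ∧
        ∃ g : ℝ → ℝ, ∀ x ∈ closedBall (0 : E N) 1, ω x = g ‖x‖) ↔
      (∃ i : ℕ, 1 ≤ i ∧ ∃ z : ℝ, IsNthZero (((N : ℝ) - 2) / (2 + α)) i z ∧
        μ = ((2 + α) / 2 * z) ^ 2)) ∧
    (∀ i : ℕ, 1 ≤ i → ∀ z : ℝ, IsNthZero (((N : ℝ) - 2) / (2 + α)) i z →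
      μ = ((2 + α) / 2 * z) ^ 2 →
      ∀ ω : E N → ℝ, IsEigenfun N α μ ω →
        (∃ g : ℝ → ℝ, ∀ x ∈ closedBall (0 : E N) 1, ω x = g ‖x‖) →
        ∃ C : ℝ, ∀ x ∈ closedBall (0 : E N) 1, x ≠ 0 →
          ω x = C * ‖x‖ ^ (-(((N : ℝ) - 2) / 2)) *
            besselJ (((N : ℝ) - 2) / (2 + α)) (z * ‖x‖ ^ ((2 + α) / 2))) := by
  have hp : 0 < 2 + α := by positivity
  refine ⟨⟨?_, ?_⟩, ?_⟩
  · rintro ⟨ω, hω, g, hg⟩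
    obtain ⟨C, hC, hωC⟩ := exists_eq_mul_radialSol hN hα hω hg
    set z := 2 * √μ / (2 + α) with hzdef
    have hz : 0 < z := div_pos (mul_pos two_pos (Real.sqrt_pos.2 hμ)) hp
    have hμz : μ = ((2 + α) / 2 * z) ^ 2 := by
      rw [hzdef, show (2 + α) / 2 * (2 * √μ / (2 + α)) = √μ by field_simp, Real.sq_sqrt hμ.le]
    let e : E N := EuclideanSpace.single ⟨0, by omega⟩ 1
    have he : ‖e‖ = 1 := by simp [e]
    have h0 : C * radialSol N α μ e = 0 := by
      rw [← hωC e (by simp [he]), hω.2.2.2.2 e he]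
    have hR := (mul_eq_zero.1 h0).resolve_left hC
    rw [hμz, radialSol_eq_zero_iff hα hz he] at hR
    obtain ⟨i, hi, hiz⟩ := exists_isNthZero (order_nonneg hN hα) hz hR
    exact ⟨i, hi, z, hiz, hμz⟩
  · rintro ⟨i, -, z, ⟨hz, hJ, -⟩, hμz⟩
    have hR := contDiff_radialSol hN hα μ
    refine ⟨radialSol N α μ, ⟨hR.contDiffOn, hR.continuous.continuousOn,
      ⟨0, by simp, radialSol_zero_ne_zero hN hα μ⟩, fun x _ => lap_radialSol hN hα μ x, ?_⟩,
      fun r => besselEntire (((N : ℝ) - 2) / (2 + α)) (μ / (2 + α) ^ 2 * r ^ (2 + α)),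
      fun x _ => rfl⟩
    intro x hx
    rw [hμz]
    exact (radialSol_eq_zero_iff hα hz hx).2 hJ
  · rintro i - z ⟨hz, -, -⟩ hμz ω hω ⟨g, hg⟩
    obtain ⟨C, -, hωC⟩ := exists_eq_mul_radialSol hN hα hω hg
    refine ⟨C * z ^ (-(((N : ℝ) - 2) / (2 + α))), fun x hx hx0 => ?_⟩
    rw [hωC x hx, hμz, radialSol_eq_besselJ hα hz hx0]
    ring
end
end

section
/- Let N ≥ 2 and α ≥ 0. Let U ∈ C²(ℝ^N) be a bounded radial function, U(x) = f(|x|), with U(0) ≠ 0, satisfying −ΔU = |x|^α U on all of ℝ^N. Then the profile f has infinitely many positive zeros; in particular the set {r > 0 : f(r) = 0} is unbounded. -/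
open Real MeasureTheory Metric Filter Topology

noncomputable section

/-- Second directional derivatives as iterated one-variable derivatives along a line. -/
theorem fderiv_fderiv_apply_eq_deriv_deriv {V : Type*} [NormedAddCommGroup V] [NormedSpace ℝ V]
    {U : V → ℝ} (hU : ContDiff ℝ 2 U) (x v : V) :
    fderiv ℝ (fun y => fderiv ℝ U y v) x v = deriv (deriv fun s : ℝ => U (x + s • v)) 0 := by
  have hline (s : ℝ) : HasDerivAt (fun s : ℝ => x + s • v) v s := by
    simpa using ((hasDerivAt_id s).smul_const v).const_add x
  have hd : Differentiable ℝ U := hU.differentiable (by norm_num)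
  have h1 : (deriv fun s : ℝ => U (x + s • v)) = fun s => fderiv ℝ U (x + s • v) v := by
    funext s
    exact ((hd _).hasFDerivAt.comp_hasDerivAt s (hline s)).deriv
  have hd' : Differentiable ℝ fun y => fderiv ℝ U y v :=
    ((hU.fderiv_right (m := 1) (by norm_num)).differentiable (by norm_num)).clm_apply
      (differentiable_const v)
  have h2 := ((hd' (x + (0 : ℝ) • v)).hasFDerivAt.comp_hasDerivAt (0 : ℝ) (hline 0)).deriv
  rw [h1]
  simpa [Function.comp_def] using h2.symm

/-- The second derivative at a point at distance `r` from the origin of a radial function with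
profile `g`, in a direction tangent to the sphere of radius `r`. -/
theorem deriv_deriv_comp_sqrt {g : ℝ → ℝ} (hg : ContDiff ℝ 2 g) {r : ℝ} (hr : 0 < r) :
    deriv (deriv fun s : ℝ => g (√(r ^ 2 + s ^ 2))) 0 = deriv g r / r := by
  have hpos (s : ℝ) : r ^ 2 + s ^ 2 ≠ 0 := by positivity
  have hsq (s : ℝ) : HasDerivAt (fun s : ℝ => √(r ^ 2 + s ^ 2)) (s / √(r ^ 2 + s ^ 2)) s := by
    convert ((hasDerivAt_pow 2 s).const_add (r ^ 2)).sqrt (hpos s) using 1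
    field_simp
    norm_num [mul_comm]
  have hd : Differentiable ℝ g := hg.differentiable (by norm_num)
  have hd' : Differentiable ℝ (deriv g) :=
    ((contDiff_succ_iff_deriv (n := 1)).1 hg).2.2.differentiable (by norm_num)
  have h1 : (deriv fun s : ℝ => g (√(r ^ 2 + s ^ 2))) =
      fun s => deriv g (√(r ^ 2 + s ^ 2)) * (s / √(r ^ 2 + s ^ 2)) := by
    funext s
    exact ((hd _).hasDerivAt.comp s (hsq s)).deriv
  have h0 : √(r ^ 2 + 0 ^ 2) = r := by simp [Real.sqrt_sq hr.le]
  have h2 := (((hd' (√(r ^ 2 + 0 ^ 2))).hasDerivAt.comp 0 (hsq 0)).mul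
    ((hasDerivAt_id (0 : ℝ)).div (hsq 0) (by rw [h0]; exact hr.ne'))).deriv
  rw [h1]
  refine h2.trans ?_
  simp only [Function.comp_apply, id, h0]
  field_simp
  simp [mul_comm]

/-- The Laplacian of a radial function in polar coordinates. -/
theorem lap_radial {N : ℕ} {U : E N → ℝ} (hU : ContDiff ℝ 2 U) {g : ℝ → ℝ} (hg : ContDiff ℝ 2 g)
    (hUg : ∀ x, U x = g ‖x‖) (i₀ : Fin N)
    (hgU : ∀ t : ℝ, g t = U (t • EuclideanSpace.single i₀ 1)) {r : ℝ} (hr : 0 < r) :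
    lap U (r • EuclideanSpace.single i₀ 1) =
      deriv (deriv g) r + (N - 1 : ℝ) * (deriv g r / r) := by
  have hterm (i : Fin N) :
      deriv (deriv fun s : ℝ => U (r • EuclideanSpace.single i₀ 1 +
        s • EuclideanSpace.single i 1)) 0 =
      deriv g r / r + if i = i₀ then deriv (deriv g) r - deriv g r / r else 0 := by
    split_ifs with h
    · subst h
      simp only [← add_smul, ← hgU]
      have h1 : (deriv fun s : ℝ => g (r + s)) = fun s => deriv g (r + s) := by
        funext s
        exact deriv_comp_const_add g r s
      rw [h1, deriv_comp_const_add]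
      simp
    · rw [add_zero, ← deriv_deriv_comp_sqrt hg hr]
      congr 2
      funext s
      rw [hUg]
      congr 1
      rw [← Real.sqrt_sq (norm_nonneg _), sq, norm_add_sq_eq_norm_sq_add_norm_sq_real]
      · simp [norm_smul, ← sq]
      · simp [inner_smul_left, inner_smul_right, EuclideanSpace.inner_single_left, Ne.symm h]
  unfold lap
  simp only [fderiv_fderiv_apply_eq_deriv_deriv hU, hterm]
  simp [Finset.sum_add_distrib]
  ring

/-- Nonzero solutions of `g'' + (n / t) g' + q g = 0` with `q ≥ 1` oscillate: by the Riccati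
equation for `w = g' / g`, the function `arctan w + t / 2` would otherwise decrease forever. -/
theorem exists_zero_ge_of_ode {g g' g'' q : ℝ → ℝ} {n : ℝ}
    (hg : ∀ t, HasDerivAt g (g' t) t) (hg' : ∀ t, HasDerivAt g' (g'' t) t)
    (hq : ∀ t, 1 ≤ t → 1 ≤ q t)
    (hode : ∀ t, 0 < t → g'' t + n * (g' t / t) + q t * g t = 0) (R : ℝ) :
    ∃ t, R ≤ t ∧ g t = 0 := by
  by_contra! hne
  set S : ℝ := max R (|n| + 1) with hS
  have hSR : R ≤ S := le_max_left _ _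
  have hSn : |n| + 1 ≤ S := le_max_right _ _
  have hder (t : ℝ) (ht : S ≤ t) : HasDerivAt (fun t => arctan (g' t / g t) + t / 2)
      (1 / (1 + (g' t / g t) ^ 2) * ((g'' t * g t - g' t * g' t) / g t ^ 2) + 1 / 2) t :=
    (((hg' t).div (hg t) (hne t (hSR.trans ht))).arctan).add ((hasDerivAt_id t).div_const 2)
  have hanti : AntitoneOn (fun t => arctan (g' t / g t) + t / 2) (Set.Ici S) := by
    refine antitoneOn_of_deriv_nonpos (convex_Ici S)
      (fun t ht => (hder t ht).continuousAt.continuousWithinAt)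
      (fun t ht => (hder t (interior_subset ht)).differentiableAt.differentiableWithinAt)
      fun t ht => ?_
    have ht : S ≤ t := interior_subset ht
    rw [(hder t ht).deriv]
    have hnz := hne t (hSR.trans ht)
    have ht1 : 1 ≤ t := by linarith [abs_nonneg n]
    have ht0 : 0 < t := by linarith
    set w := g' t / g t with hw
    have hgw : g' t = w * g t := by rw [hw]; field_simp
    have hric : (g'' t * g t - g' t * g' t) / g t ^ 2 = -q t - n / t * w - w ^ 2 := by
      have : g'' t = -(n * (g' t / t)) - q t * g t := by linarith [hode t ht0]
      rw [this, hgw]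
      field_simp
      ring
    have hm : (n / t) ^ 2 ≤ 1 := by
      rw [sq_le_one_iff_abs_le_one, abs_div, abs_of_pos ht0, div_le_one ht0]
      linarith
    rw [hric, one_div_mul_eq_div, div_add_div _ _ (by positivity) (by norm_num)]
    refine div_nonpos_of_nonpos_of_nonneg ?_ (by positivity)
    nlinarith [sq_nonneg (n / t + w), hq t ht1]
  have h := hanti (Set.mem_Ici.2 le_rfl) (Set.mem_Ici.2 (by linarith [pi_pos] : S ≤ S + 2 * π))
    (by linarith [pi_pos])
  simp only at h
  linarith [neg_pi_div_two_lt_arctan (g' (S + 2 * π) / g (S + 2 * π)),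
    arctan_lt_pi_div_two (g' S / g S)]

/-- a bounded radial `C²` solution of `−ΔU = |x|^α U` on all of `ℝ^N` with
`U(0) ≠ 0` has a profile with infinitely many positive zeros; in particular the set of
positive zeros is unbounded. -/
theorem stmt_6 (N : ℕ) (hN : 2 ≤ N) (α : ℝ) (hα : 0 ≤ α)
    (U : E N → ℝ) (f : ℝ → ℝ)
    (hC2 : ContDiff ℝ 2 U) (hbdd : ∃ C : ℝ, ∀ x, |U x| ≤ C)
    (hrad : ∀ x, U x = f ‖x‖) (h0 : U 0 ≠ 0)
    (heq : ∀ x : E N, -lap U x = ‖x‖ ^ α * U x) :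
    {r : ℝ | 0 < r ∧ f r = 0}.Infinite ∧ ¬ BddAbove {r : ℝ | 0 < r ∧ f r = 0} := by
  have hunb : ¬ BddAbove {r : ℝ | 0 < r ∧ f r = 0} := by
    rintro ⟨B, hB⟩
    set e : E N := EuclideanSpace.single ⟨0, by omega⟩ 1 with he
    have hnorm : ‖e‖ = 1 := by simp [he]
    set g : ℝ → ℝ := fun t => U (t • e) with hgdef
    have hgf (t : ℝ) (ht : 0 ≤ t) : g t = f t := by
      simp [hgdef, hrad, norm_smul, hnorm, abs_of_nonneg ht]
    have hg : ContDiff ℝ 2 g := hC2.comp (contDiff_id.smul contDiff_const)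
    have hd : Differentiable ℝ g := hg.differentiable (by norm_num)
    have hd' : Differentiable ℝ (deriv g) :=
      ((contDiff_succ_iff_deriv (n := 1)).1 hg).2.2.differentiable (by norm_num)
    obtain ⟨t, htR, ht⟩ := exists_zero_ge_of_ode (q := fun t => t ^ α) (n := (N - 1 : ℝ))
      (fun t => (hd t).hasDerivAt) (fun t => (hd' t).hasDerivAt)
      (fun t ht => one_le_rpow ht hα)
      (fun t ht => by
        have h1 := lap_radial hC2 hg (fun x => by rw [hgf _ (norm_nonneg x), hrad])
          ⟨0, by omega⟩ (fun _ => rfl) ht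
        have h2 := heq (t • e)
        rw [h1, norm_smul, hnorm, mul_one, Real.norm_of_nonneg ht.le] at h2
        linarith) (max 1 (B + 1))
    have ht1 : 1 ≤ t := (le_max_left _ _).trans htR
    have htB : B + 1 ≤ t := (le_max_right _ _).trans htR
    have := hB (show t ∈ {r : ℝ | 0 < r ∧ f r = 0} from
      ⟨by linarith, by rw [← hgf t (by linarith), ht]⟩)
    linarith
  exact ⟨fun hfin => hunb hfin.bddAbove, hunb⟩
end
end

section
/- Let M > 1 and 0 ≤ a < b. Let ψ : (a,b] → ℝ be a function for which there exists a measurable g : (a,b) → ℝ with ∫_a^b s^{M−1} g(s)² ds < ∞ such that ψ(t) = −∫_t^b g(s) ds for every t ∈ (a,b]. Then ∫_a^b t^{M−1} ψ(t)² dt ≤ (b(b−a)/(M−1)) ∫_a^b t^{M−1} g(t)² dt. -/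
open Real MeasureTheory Set

noncomputable section

/-- The integral of `s ^ (-M)` over `(t, b)` is at most its value over `(t, ∞)`. -/
lemma setIntegral_rpow_neg_le {M t b : ℝ} (hM : 1 < M) (ht : 0 < t) (htb : t ≤ b) :
    ∫ s in Ioo t b, s ^ (-M) ≤ t ^ (1 - M) / (M - 1) := by
  have h0 : (0 : ℝ) ∉ uIcc t b := by
    rw [uIcc_of_le htb]
    exact fun h => ht.not_ge h.1
  rw [← integral_Ioc_eq_integral_Ioo, ← intervalIntegral.integral_of_le htb,
    integral_rpow (Or.inr ⟨by linarith, h0⟩), neg_add_eq_sub, ← neg_div_neg_eq, neg_sub, neg_sub]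
  have := rpow_nonneg (ht.le.trans htb) (1 - M)
  gcongr
  · linarith

/-- Weighted Cauchy–Schwarz bound for the primitive of `g` vanishing at `b`. -/
lemma rpow_mul_sq_setIntegral_le {M t b : ℝ} (hM : 1 < M) (ht : 0 < t) (htb : t < b) {g : ℝ → ℝ}
    (hg : IntegrableOn (fun s => s ^ (M - 1) * g s ^ 2) (Ioo t b)) :
    t ^ (M - 1) * (∫ s in Ioo t b, g s) ^ 2 ≤
      b / (M - 1) * ∫ s in Ioo t b, s ^ (M - 1) * g s ^ 2 := by
  have hb : 0 < b := ht.trans htb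
  have hM' : 0 < M - 1 := sub_pos.2 hM
  have hI : 0 ≤ ∫ s in Ioo t b, s ^ (M - 1) * g s ^ 2 :=
    setIntegral_nonneg measurableSet_Ioo fun s hs =>
      mul_nonneg (rpow_nonneg (ht.trans hs.1).le _) (sq_nonneg _)
  by_cases hgi : IntegrableOn g (Ioo t b)
  swap
  · rw [integral_undef hgi]
    simpa using mul_nonneg (div_pos hb hM').le hI
  have hw : IntegrableOn (fun s : ℝ => s ^ (-M)) (Ioo t b) := by
    refine ContinuousOn.integrableOn_Icc (fun s hs => ?_) |>.mono_set Ioo_subset_Icc_self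
    exact (continuousAt_rpow_const s _ (Or.inl (ht.trans_le hs.1).ne')).continuousWithinAt
  set G := ∫ s in Ioo t b, g s
  set I := ∫ s in Ioo t b, s ^ (M - 1) * g s ^ 2
  have key (r : ℝ) : 2 * r * G ≤ r ^ 2 * b * (t ^ (1 - M) / (M - 1)) + I := by
    calc 2 * r * G = ∫ s in Ioo t b, 2 * r * g s := (integral_const_mul _ _).symm
      _ ≤ ∫ s in Ioo t b, (r ^ 2 * b * s ^ (-M) + s ^ (M - 1) * g s ^ 2) := by
        refine setIntegral_mono_on (hgi.const_mul _) ((hw.const_mul _).add hg)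
          measurableSet_Ioo fun s hs => ?_
        have hs0 : 0 < s := ht.trans hs.1
        have hp : 0 < s ^ (M - 1) := rpow_pos_of_pos hs0 _
        have hq : s ^ (-M) = (s * s ^ (M - 1))⁻¹ := by
          rw [rpow_neg hs0.le, ← rpow_one_add' hs0.le (by linarith)]
          congr 2
          ring
        have hle : (s ^ (M - 1))⁻¹ ≤ b * s ^ (-M) := by
          rw [hq, mul_inv, ← mul_assoc, ← div_eq_mul_inv b]
          exact le_mul_of_one_le_left (inv_pos.2 hp).le ((one_le_div hs0).2 hs.2.le)
        have hsq : 0 ≤ (s ^ (M - 1))⁻¹ * (r - s ^ (M - 1) * g s) ^ 2 := by positivity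
        have hexp : (s ^ (M - 1))⁻¹ * (r - s ^ (M - 1) * g s) ^ 2 =
            r ^ 2 * (s ^ (M - 1))⁻¹ - 2 * r * g s + s ^ (M - 1) * g s ^ 2 := by
          field_simp
          ring
        have := mul_le_mul_of_nonneg_left hle (sq_nonneg r)
        linarith
      _ = r ^ 2 * b * (∫ s in Ioo t b, s ^ (-M)) + I := by
        rw [integral_add (hw.const_mul _) hg, integral_const_mul]
      _ ≤ _ := by
        gcongr
        exact setIntegral_rpow_neg_le hM ht htb.le
  have hp : 0 < t ^ (M - 1) := rpow_pos_of_pos ht _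
  have ht' : t ^ (1 - M) = (t ^ (M - 1))⁻¹ := by rw [← rpow_neg ht.le, neg_sub]
  have h := mul_le_mul_of_nonneg_left (key (G * t ^ (M - 1) * (M - 1) / b)) (div_pos hb hM').le
  rw [ht'] at h
  have h₁ : b / (M - 1) * (2 * (G * t ^ (M - 1) * (M - 1) / b) * G) =
      2 * (t ^ (M - 1) * G ^ 2) := by
    field_simp
  have h₂ : b / (M - 1) * ((G * t ^ (M - 1) * (M - 1) / b) ^ 2 * b *
      ((t ^ (M - 1))⁻¹ / (M - 1)) + I) = t ^ (M - 1) * G ^ 2 + b / (M - 1) * I := by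
    field_simp
  linarith

/-- weighted Poincaré inequality on `(a,b)` with weight `t^{M−1}` for
functions vanishing at `b` with weak derivative `g` in the weighted `L²` space. -/
theorem stmt_10 (M a b : ℝ) (hM : 1 < M) (ha : 0 ≤ a) (hab : a < b)
    (ψ g : ℝ → ℝ) (hgm : Measurable g)
    (hgint : IntegrableOn (fun s => s ^ (M - 1) * g s ^ 2) (Ioo a b))
    (hψ : ∀ t ∈ Ioc a b, ψ t = -∫ s in Ioo t b, g s) :
    ∫ t in Ioo a b, t ^ (M - 1) * ψ t ^ 2 ≤
      (b * (b - a) / (M - 1)) * ∫ t in Ioo a b, t ^ (M - 1) * g t ^ 2 := by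
  have hnn (f : ℝ → ℝ) : ∀ s ∈ Ioo a b, 0 ≤ s ^ (M - 1) * f s ^ 2 := fun s hs =>
    mul_nonneg (rpow_nonneg (ha.trans hs.1.le) _) (sq_nonneg _)
  have hbound : ∀ t ∈ Ioo a b, ‖t ^ (M - 1) * ψ t ^ 2‖ ≤
      b / (M - 1) * ∫ s in Ioo a b, s ^ (M - 1) * g s ^ 2 := fun t ht => by
    have hsub : Ioo t b ⊆ Ioo a b := Ioo_subset_Ioo_left ht.1.le
    rw [norm_of_nonneg (hnn ψ t ht), hψ t ⟨ht.1, ht.2.le⟩, neg_sq]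
    refine (rpow_mul_sq_setIntegral_le hM (ha.trans_lt ht.1) ht.2 (hgint.mono_set hsub)).trans
      (mul_le_mul_of_nonneg_left ?_ (div_nonneg (ha.trans hab.le) (sub_pos.2 hM).le))
    exact setIntegral_mono_set hgint
      (ae_restrict_of_forall_mem measurableSet_Ioo (hnn g)) hsub.eventuallyLE
  have h := (le_norm_self _).trans
    (norm_setIntegral_le_of_norm_le_const (μ := volume) (by simp) hbound)
  rw [volume_real_Ioo_of_le hab.le] at h
  exact h.trans_eq (by ring)
end
end
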